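/- Assume condition (G) for some γ ∈ ℕ, d > 0 and L > 0, and let 0 ≤ K < L with [K]+1 ≤ γ. For φ ∈ L¹_K set v(x,t) := (e^{tℒ}φ)(x) − Σ_{|α| ≤ K} M_α(φ,0) g_α(x,t). Then for any j ∈ {0,…,γ}, q ∈ [1,∞] and ℓ ∈ [0,K], lim_{t→∞} t^{K/d} [ t^{(N/d)(1−1/q)+j/d} ‖∇^j v(·,t)‖_q + t^{−ℓ/d + j/d} |||∇^j v(·,t)|||_ℓ ] = 0. -/

import Mathlib

open MeasureTheory Filter Asymptotics Topology
open scoped ENNReal BigOperators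

noncomputable section

/-- Partial derivative in the `i`-th coordinate direction. -/
def pderivE (N : ℕ) (i : Fin N) (f : EuclideanSpace ℝ (Fin N) → ℝ) :
    EuclideanSpace ℝ (Fin N) → ℝ :=
  fun x => fderiv ℝ f x (EuclideanSpace.single i 1)

/-- Multi-index partial derivative `∂_x^α`. -/
def mderivE (N : ℕ) (α : Fin N → ℕ) (f : EuclideanSpace ℝ (Fin N) → ℝ) :
    EuclideanSpace ℝ (Fin N) → ℝ :=
  (List.ofFn fun i : Fin N => (pderivE N i)^[α i]).foldr (fun T h => T h) f

/-- `x ^ α` for a multi-index `α`. -/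
def mpowE (N : ℕ) (α : Fin N → ℕ) (x : EuclideanSpace ℝ (Fin N)) : ℝ :=
  ∏ i, x i ^ α i

/-- `α !` for a multi-index `α`. -/
def mfactE (N : ℕ) (α : Fin N → ℕ) : ℕ := ∏ i, Nat.factorial (α i)

/-- `g_α(x,t) := ((-1)^{|α|}/α!) ∂_x^α G(x, t+1)`. -/
def gA (N : ℕ) (G : EuclideanSpace ℝ (Fin N) → ℝ → ℝ) (α : Fin N → ℕ)
    (x : EuclideanSpace ℝ (Fin N)) (t : ℝ) : ℝ :=
  ((-1 : ℝ) ^ (∑ i, α i) / (mfactE N α : ℝ)) * mderivE N α (fun y => G y (t + 1)) x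

/-- Condition (G) for the kernel `G` with parameters `γ`, `d`, `L`. -/
structure CondG (N : ℕ) (G : EuclideanSpace ℝ (Fin N) → ℝ → ℝ) (γ : ℕ) (d L : ℝ) : Prop where
  smooth : ContDiffOn ℝ γ (fun p : EuclideanSpace ℝ (Fin N) × ℝ => G p.1 p.2) {p | 0 < p.2}
  scaling : ∀ x : EuclideanSpace ℝ (Fin N), ∀ t : ℝ, 0 < t →
      G x t = t ^ (-(N : ℝ) / d) * G ((t ^ (-(1 : ℝ) / d)) • x) 1
  decay : ∀ j : ℕ, j ≤ γ → ∃ C : ℝ, ∀ x : EuclideanSpace ℝ (Fin N),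
      (1 + ‖x‖) ^ ((N : ℝ) + L + j) * ‖iteratedFDeriv ℝ j (fun y => G y 1) x‖ ≤ C
  semigroup : ∀ x : EuclideanSpace ℝ (Fin N), ∀ t s : ℝ, 0 < s → s < t →
      G x t = ∫ y, G (x - y) (t - s) * G y s

/-- `(e^{tℒ}φ)(x) = ∫ G(x-y,t) φ(y) dy`. -/
def sgOp (N : ℕ) (G : EuclideanSpace ℝ (Fin N) → ℝ → ℝ) (t : ℝ)
    (φ : EuclideanSpace ℝ (Fin N) → ℝ) : EuclideanSpace ℝ (Fin N) → ℝ :=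
  fun x => ∫ y, G (x - y) t * φ y

/-- `∫ x^α f(x) dx`. -/
def momE (N : ℕ) (α : Fin N → ℕ) (f : EuclideanSpace ℝ (Fin N) → ℝ) : ℝ :=
  ∫ x, mpowE N α x * f x

/-- Auxiliary fuelled recursion computing the coefficients `M_α(f,t)`. -/
def McoefAux (N : ℕ) (G : EuclideanSpace ℝ (Fin N) → ℝ → ℝ)
    (f : EuclideanSpace ℝ (Fin N) → ℝ) (t : ℝ) : ℕ → (Fin N → ℕ) → ℝ
  | 0, α => momE N α f
  | n + 1, α => momE N α f -
      ∑ β ∈ (Finset.Iic α).erase α,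
        McoefAux N G f t n β * ∫ x, mpowE N α x * gA N G β x t

/-- `M_α(f,t)`, defined inductively on `|α|`:
`M_α(f,t) = ∫ x^α f dx - ∑_{β ≤ α, β ≠ α} M_β(f,t) ∫ x^α g_β(x,t) dx`. -/
def Mcoef (N : ℕ) (G : EuclideanSpace ℝ (Fin N) → ℝ → ℝ)
    (f : EuclideanSpace ℝ (Fin N) → ℝ) (t : ℝ) (α : Fin N → ℕ) : ℝ :=
  McoefAux N G f t (∑ i, α i) α

/-- The finite set of multi-indices `α` with `|α| ≤ m`. -/
def multiIdx (N m : ℕ) : Finset (Fin N → ℕ) :=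
  (Finset.Iic fun _ => m).filter fun α => ∑ i, α i ≤ m

/-- `P_K(t)f := f - ∑_{|α| ≤ K} M_α(f,t) g_α(·,t)`. -/
def PKop (N : ℕ) (G : EuclideanSpace ℝ (Fin N) → ℝ → ℝ) (K : ℝ) (t : ℝ)
    (f : EuclideanSpace ℝ (Fin N) → ℝ) : EuclideanSpace ℝ (Fin N) → ℝ :=
  fun x => f x - ∑ α ∈ multiIdx N ⌊K⌋₊, Mcoef N G f t α * gA N G α x t

/-- The weighted `L¹` norm `|||φ|||_k = ∫ (1+|x|^k) ‖φ(x)‖ dx`, valued in `ℝ≥0∞`. -/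
def wnorm (N : ℕ) {E' : Type*} [NormedAddCommGroup E'] (k : ℝ)
    (φ : EuclideanSpace ℝ (Fin N) → E') : ℝ≥0∞ :=
  ∫⁻ x, ENNReal.ofReal ((1 + ‖x‖ ^ k) * ‖φ x‖)

/-- Membership in `L¹_k = L¹(ℝ^N, (1+|x|^k)dx)`. -/
def MemL1k (N : ℕ) (k : ℝ) (φ : EuclideanSpace ℝ (Fin N) → ℝ) : Prop :=
  AEStronglyMeasurable φ (volume : Measure (EuclideanSpace ℝ (Fin N))) ∧ wnorm N k φ < ⊤

/-- `E_{K,q}[f](t) = (1+t)^{K/d}[t^{(N/d)(1-1/q)} ‖f(t)‖_q + ‖f(t)‖_1] + |||f(t)|||_K`. -/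
def Efun (N : ℕ) (d K : ℝ) (q : ℝ≥0∞) (f : EuclideanSpace ℝ (Fin N) → ℝ → ℝ) (t : ℝ) :
    ℝ≥0∞ :=
  ENNReal.ofReal ((1 + t) ^ (K / d)) *
      (ENNReal.ofReal (t ^ (((N : ℝ) / d) * (1 - q.toReal⁻¹))) *
          eLpNorm (fun x => f x t) q volume +
        eLpNorm (fun x => f x t) 1 volume) +
    wnorm N K (fun x => f x t)

/-- `t^{(N/d)(1-1/q)} ‖w(t)‖_q + t^{-ℓ/d} |||w(t)|||_ℓ`. -/
def DistQ (N : ℕ) (d : ℝ) (q : ℝ≥0∞) (ℓ : ℝ) (w : EuclideanSpace ℝ (Fin N) → ℝ → ℝ)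
    (t : ℝ) : ℝ≥0∞ :=
  ENNReal.ofReal (t ^ (((N : ℝ) / d) * (1 - q.toReal⁻¹))) * eLpNorm (fun x => w x t) q volume +
    ENNReal.ofReal (t ^ (-ℓ / d)) * wnorm N ℓ (fun x => w x t)

end

section Convolution

variable {E F : Type*} [NormedAddCommGroup E] [NormedSpace ℝ E] [FiniteDimensional ℝ E]
  [MeasurableSpace E] [BorelSpace E] [NormedAddCommGroup F] [NormedSpace ℝ F]

theorem lintegral_comp_smul_addHaar (μ : Measure E) [μ.IsAddHaarMeasure] (f : E → ℝ≥0∞) {a : ℝ}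
    (ha : a ≠ 0) :
    ∫⁻ x, f (a • x) ∂μ = ENNReal.ofReal |(a ^ Module.finrank ℝ E)⁻¹| * ∫⁻ x, f x ∂μ := by
  let e : E ≃ᵐ E := (Homeomorph.smul (Units.mk0 a ha)).toMeasurableEquiv
  have he : (e : E → E) = fun x => a • x := rfl
  calc ∫⁻ x, f (a • x) ∂μ = ∫⁻ x, f (e x) ∂μ := rfl
    _ = ∫⁻ x, f x ∂(Measure.map e μ) := (lintegral_map_equiv f e).symm
    _ = _ := by rw [he, Measure.map_addHaar_smul μ ha, lintegral_smul_measure, smul_eq_mul]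

variable {μ : Measure E} {u : E → ℝ} {h : E → F}

theorem integrable_smul_comp_sub (hu : Integrable u μ) (hh : Continuous h) {C : ℝ}
    (hC : ∀ x, ‖h x‖ ≤ C) (x : E) : Integrable (fun y => u y • h (x - y)) μ :=
  hu.smul_bdd C (by fun_prop : Continuous fun y => h (x - y)).aestronglyMeasurable
    (ae_of_all _ fun y => hC (x - y))

theorem hasFDerivAt_integral_smul_comp_sub (hu : Integrable u μ) (hh : ContDiff ℝ 1 h) {C D : ℝ}
    (hC : ∀ x, ‖h x‖ ≤ C) (hD : ∀ x, ‖fderiv ℝ h x‖ ≤ D) (x : E) :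
    HasFDerivAt (fun x => ∫ y, u y • h (x - y) ∂μ) (∫ y, u y • fderiv ℝ h (x - y) ∂μ) x := by
  have hh' : Continuous (fderiv ℝ h) := hh.continuous_fderiv one_ne_zero
  refine hasFDerivAt_integral_of_dominated_of_fderiv_le (s := Set.univ)
    (bound := fun y => ‖u y‖ * D) (F' := fun x y => u y • fderiv ℝ h (x - y)) univ_mem
    (Eventually.of_forall fun x =>
      (integrable_smul_comp_sub hu hh.continuous hC x).aestronglyMeasurable)
    (integrable_smul_comp_sub hu hh.continuous hC x)
    (integrable_smul_comp_sub hu hh' hD x).aestronglyMeasurable ?_ (hu.norm.mul_const D) ?_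
  · refine ae_of_all _ fun y x _ => ?_
    rw [norm_smul]
    exact mul_le_mul_of_nonneg_left (hD _) (norm_nonneg _)
  · refine ae_of_all _ fun y x _ => ?_
    have h1 : HasFDerivAt h (fderiv ℝ h (x - y)) (x - y) :=
      (hh.differentiable one_ne_zero _).hasFDerivAt
    exact ((hasFDerivAt_comp_sub y).2 h1).const_smul (u y)

theorem iteratedFDeriv_integral_smul_comp_sub (hu : Integrable u μ) {n : ℕ} (hh : ContDiff ℝ n h)
    (hC : ∀ i ≤ n, ∃ C, ∀ x, ‖iteratedFDeriv ℝ i h x‖ ≤ C) {j : ℕ} (hj : j ≤ n) :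
    iteratedFDeriv ℝ j (fun x => ∫ y, u y • h (x - y) ∂μ) =
      fun x => ∫ y, u y • iteratedFDeriv ℝ j h (x - y) ∂μ := by
  induction j with
  | zero =>
    ext x m
    obtain ⟨C, hC⟩ := hC 0 hj
    rw [ContinuousMultilinearMap.integral_apply]
    · simp
    · exact integrable_smul_comp_sub hu (hh.continuous_iteratedFDeriv (by exact_mod_cast hj)) hC x
  | succ j ih =>
    have hj' : ((j + 1 : ℕ) : WithTop ℕ∞) ≤ n := by exact_mod_cast hj
    have hsm : ContDiff ℝ 1 (iteratedFDeriv ℝ j h) :=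
      hh.iteratedFDeriv_right (by rw [add_comm]; exact_mod_cast hj)
    obtain ⟨C, hC1⟩ := hC j (by omega)
    obtain ⟨D, hD1⟩ := hC (j + 1) hj
    have hD : ∀ x, ‖fderiv ℝ (iteratedFDeriv ℝ j h) x‖ ≤ D := fun x => by
      rw [norm_fderiv_iteratedFDeriv]; exact hD1 x
    ext x m
    rw [iteratedFDeriv_succ_apply_left, ih (by omega),
      (hasFDerivAt_integral_smul_comp_sub hu hsm hC1 hD x).fderiv]
    have h1 := integrable_smul_comp_sub hu (hsm.continuous_fderiv one_ne_zero) hD x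
    rw [ContinuousLinearMap.integral_apply h1,
      ContinuousMultilinearMap.integral_apply (h1.apply_continuousLinearMap _),
      ContinuousMultilinearMap.integral_apply
        (integrable_smul_comp_sub hu (hh.continuous_iteratedFDeriv hj') hD1 x)]
    simp [iteratedFDeriv_succ_apply_left]

end Convolution

section MultiIndex

variable {N : ℕ}

/-- `h` is of class `C^n` and its derivatives of order at most `n` decay like `(1 + |x|)^(-r)`. -/
def DecayCD {E : Type*} [NormedAddCommGroup E] [NormedSpace ℝ E] (r : ℝ) (n : ℕ) (h : E → ℝ) :
    Prop :=
  ContDiff ℝ n h ∧ ∀ i ≤ n, ∃ C : ℝ, ∀ x, (1 + ‖x‖) ^ r * ‖iteratedFDeriv ℝ i h x‖ ≤ C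

theorem DecayCD.of_le {E : Type*} [NormedAddCommGroup E] [NormedSpace ℝ E] {r : ℝ} {n k : ℕ}
    {h : E → ℝ} (hh : DecayCD r n h) (hk : k ≤ n) : DecayCD r k h :=
  ⟨hh.1.of_le (by exact_mod_cast hk), fun i hi => hh.2 i (hi.trans hk)⟩

theorem DecayCD.pderivE {r : ℝ} {n : ℕ} {h : EuclideanSpace ℝ (Fin N) → ℝ}
    (hh : DecayCD r (n + 1) h) (i : Fin N) : DecayCD r n (pderivE N i h) := by
  have hd : ContDiff ℝ n (fderiv ℝ h) := hh.1.fderiv_right (by norm_cast)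
  let T : (EuclideanSpace ℝ (Fin N) →L[ℝ] ℝ) →L[ℝ] ℝ :=
    ContinuousLinearMap.apply ℝ ℝ (EuclideanSpace.single i (1 : ℝ))
  have hT : _root_.pderivE N i h = T ∘ fderiv ℝ h := rfl
  refine ⟨hT ▸ T.contDiff.comp hd, fun k hk => ?_⟩
  obtain ⟨C, hC⟩ := hh.2 (k + 1) (by omega)
  refine ⟨‖T‖ * C, fun x => ?_⟩
  have h1 := T.norm_iteratedFDeriv_comp_left (x := x) hd.contDiffAt (n := k) (by exact_mod_cast hk)
  rw [norm_iteratedFDeriv_fderiv] at h1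
  calc _ ≤ (1 + ‖x‖) ^ r * (‖T‖ * ‖iteratedFDeriv ℝ (k + 1) h x‖) := by
        rw [hT]; gcongr
    _ = ‖T‖ * ((1 + ‖x‖) ^ r * ‖iteratedFDeriv ℝ (k + 1) h x‖) := by ring
    _ ≤ _ := by gcongr; exact hC x

theorem DecayCD.foldr_pderivE {r : ℝ} {n : ℕ} {h : EuclideanSpace ℝ (Fin N) → ℝ}
    (l : List (Fin N)) (hh : DecayCD r (l.length + n) h) :
    DecayCD r n (l.foldr (_root_.pderivE N) h) := by
  induction l generalizing n with
  | nil => simpa using hh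
  | cons i l ih =>
    exact (ih (n := n + 1) (by convert hh using 1; simp; omega)).pderivE i

theorem DecayCD.norm_le_rpow {E : Type*} [NormedAddCommGroup E] [NormedSpace ℝ E] {r : ℝ} {n i : ℕ}
    {h : E → ℝ} (hh : DecayCD r n h) (hi : i ≤ n) :
    ∃ C : ℝ, 0 ≤ C ∧ ∀ x, ‖iteratedFDeriv ℝ i h x‖ ≤ C * (1 + ‖x‖) ^ (-r) := by
  obtain ⟨C, hC⟩ := hh.2 i hi
  refine ⟨C, (by positivity : (0 : ℝ) ≤ _).trans (hC 0), fun x => ?_⟩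
  rw [Real.rpow_neg (by positivity), ← div_eq_mul_inv, le_div_iff₀' (by positivity)]
  exact hC x

theorem exists_list_mderivE (α : Fin N → ℕ) :
    ∃ l : List (Fin N), (∀ i, l.count i = α i) ∧ l.length = ∑ i, α i ∧
      ∀ f, mderivE N α f = l.foldr (pderivE N) f := by
  refine ⟨(List.finRange N).flatMap fun i => List.replicate (α i) i, fun i => ?_, ?_, fun f => ?_⟩
  · rw [List.count_flatMap, ← List.ofFn_eq_map, List.sum_ofFn]
    simp [List.count_replicate]
  · rw [List.length_flatMap, ← List.ofFn_eq_map, List.sum_ofFn]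
    simp
  · have key : ∀ L : List (Fin N),
        (L.map fun i => (pderivE N i)^[α i]).foldr (fun T h => T h) f =
          (L.flatMap fun i => List.replicate (α i) i).foldr (pderivE N) f := by
      intro L
      induction L with
      | nil => rfl
      | cons i L ih =>
        rw [List.flatMap_cons, List.foldr_append, ← ih, List.map_cons, List.foldr_cons]
        generalize (L.map fun i => (pderivE N i)^[α i]).foldr (fun T h => T h) f = g
        generalize α i = k
        induction k with
        | zero => rfl
        | succ k ihk => rw [Function.iterate_succ_apply', ihk, List.replicate_succ, List.foldr_cons]
    rw [mderivE, List.ofFn_eq_map, key]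

theorem abs_mpowE_le (α : Fin N → ℕ) (x : EuclideanSpace ℝ (Fin N)) :
    |mpowE N α x| ≤ (1 + ‖x‖) ^ ((∑ i, α i : ℕ) : ℝ) := by
  rw [mpowE, Finset.abs_prod, Real.rpow_natCast, ← Finset.prod_pow_eq_pow_sum]
  gcongr with i
  rw [abs_pow]
  gcongr
  have := PiLp.norm_apply_le x i
  rw [Real.norm_eq_abs] at this
  linarith

theorem sum_update_pred_le (α : Fin N → ℕ) (i : Fin N) :
    ∑ k, Function.update α i (α i - 1) k ≤ ∑ k, α k :=
  Finset.sum_le_sum fun k _ => by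
    rcases eq_or_ne k i with rfl | hk
    · simp
    · simp [hk]

theorem contDiff_mpowE (α : Fin N → ℕ) {n : WithTop ℕ∞} : ContDiff ℝ n (mpowE N α) := by
  unfold mpowE
  fun_prop

theorem fderiv_mpowE_single (α : Fin N → ℕ) (i : Fin N) (x : EuclideanSpace ℝ (Fin N)) :
    fderiv ℝ (mpowE N α) x (EuclideanSpace.single i 1) =
      α i * mpowE N (Function.update α i (α i - 1)) x := by
  have h1 : ∀ k : Fin N, HasFDerivAt (fun x : EuclideanSpace ℝ (Fin N) => x k ^ α k)
      (((α k : ℝ) * x k ^ (α k - 1)) • (EuclideanSpace.proj k : _ →L[ℝ] ℝ)) x := fun k => by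
    simpa using (EuclideanSpace.proj (𝕜 := ℝ) k).hasFDerivAt.pow (x := x) (α k)
  have h2 := HasFDerivAt.finsetProd (u := Finset.univ) (fun k _ => h1 k)
  have h3 : fderiv ℝ (mpowE N α) x = _ := h2.fderiv
  rw [h3, _root_.sum_apply, Finset.sum_eq_single i]
  · rw [mpowE, ← Finset.mul_prod_erase Finset.univ _ (Finset.mem_univ i)]
    have : ∏ k ∈ Finset.univ.erase i, x k ^ Function.update α i (α i - 1) k =
        ∏ k ∈ Finset.univ.erase i, x k ^ α k := by
      refine Finset.prod_congr rfl fun k hk => ?_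
      rw [Function.update_of_ne (Finset.ne_of_mem_erase hk)]
    rw [this]
    simp
    ring
  · intro k _ hk
    simp [hk]
  · simp

theorem integrable_mpowE_mul {r : ℝ} {n : ℕ} {h : EuclideanSpace ℝ (Fin N) → ℝ}
    (hh : DecayCD r n h) {α : Fin N → ℕ} (hα : ((∑ i, α i : ℕ) : ℝ) + N < r) :
    Integrable fun x => mpowE N α x * h x := by
  obtain ⟨C, hC0, hC⟩ := hh.norm_le_rpow (Nat.zero_le n)
  have h1 : Integrable fun x : EuclideanSpace ℝ (Fin N) =>
      C * (1 + ‖x‖) ^ (-(r - (∑ i, α i : ℕ))) :=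
    (integrable_one_add_norm (by rw [finrank_euclideanSpace_fin]; linarith)).const_mul C
  refine h1.mono' ((contDiff_mpowE α (n := 0)).continuous.mul hh.1.continuous).aestronglyMeasurable
    (ae_of_all _ fun x => ?_)
  have h2 := hC x
  rw [norm_iteratedFDeriv_zero] at h2
  rw [norm_mul, Real.norm_eq_abs (mpowE N α x), neg_sub, sub_eq_add_neg,
    Real.rpow_add (by positivity)]
  calc _ ≤ (1 + ‖x‖) ^ ((∑ i, α i : ℕ) : ℝ) * (C * (1 + ‖x‖) ^ (-r)) := by
        gcongr
        exact abs_mpowE_le α x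
    _ = _ := by ring

theorem integral_mpowE_mul_pderivE {r : ℝ} {h : EuclideanSpace ℝ (Fin N) → ℝ}
    (hh : DecayCD r 1 h) {α : Fin N → ℕ} (hα : ((∑ i, α i : ℕ) : ℝ) + N < r) (i : Fin N) :
    ∫ x, mpowE N α x * pderivE N i h x =
      -(α i * ∫ x, mpowE N (Function.update α i (α i - 1)) x * h x) := by
  have hle := sum_update_pred_le α i
  have hα' : ((∑ k, Function.update α i (α i - 1) k : ℕ) : ℝ) + N < r := by
    have : ((∑ k, Function.update α i (α i - 1) k : ℕ) : ℝ) ≤ (∑ i, α i : ℕ) := by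
      exact_mod_cast hle
    linarith
  have := integral_mul_fderiv_eq_neg_fderiv_mul_of_integrable (μ := volume) (f := mpowE N α)
    (g := h) (v := EuclideanSpace.single i 1) ?_ (integrable_mpowE_mul (hh.pderivE i (n := 0)) hα)
    (integrable_mpowE_mul hh hα)
    (fun x _ => (contDiff_mpowE α (n := 1)).differentiable one_ne_zero x)
    (fun x _ => hh.1.differentiable (by simp) x)
  · rw [← integral_const_mul]
    simpa only [pderivE, fderiv_mpowE_single, mul_assoc] using this
  · simp only [fderiv_mpowE_single, mul_assoc]
    exact (integrable_mpowE_mul hh hα').const_mul _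

theorem integral_mpowE_mul_foldr_pderivE_eq_zero {r : ℝ} {h : EuclideanSpace ℝ (Fin N) → ℝ}
    {l : List (Fin N)} (hh : DecayCD r l.length h) {α : Fin N → ℕ}
    (hα : ((∑ i, α i : ℕ) : ℝ) + N < r) {k : Fin N} (hk : α k < l.count k) :
    ∫ x, mpowE N α x * l.foldr (pderivE N) h x = 0 := by
  induction l generalizing α with
  | nil => simp at hk
  | cons i l ih =>
    rw [List.foldr_cons,
      integral_mpowE_mul_pderivE (DecayCD.foldr_pderivE (n := 1) l (by simpa using hh)) hα i]
    rcases Nat.eq_zero_or_pos (α i) with h0 | h0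
    · simp [h0]
    · rw [ih (hh.of_le (by simp)), mul_zero, neg_zero]
      · have hle := sum_update_pred_le α i
        have : ((∑ k, Function.update α i (α i - 1) k : ℕ) : ℝ) ≤ (∑ i, α i : ℕ) := by
          exact_mod_cast hle
        linarith
      · rcases eq_or_ne k i with rfl | hki
        · simp at hk ⊢; omega
        · simpa [hki, List.count_cons, hki.symm] using hk

theorem integral_mpowE_mul_foldr_pderivE_self {r : ℝ} {h : EuclideanSpace ℝ (Fin N) → ℝ}
    {l : List (Fin N)} (hh : DecayCD r l.length h) {α : Fin N → ℕ}
    (hα : ((∑ i, α i : ℕ) : ℝ) + N < r) (hl : ∀ k, l.count k = α k) :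
    ∫ x, mpowE N α x * l.foldr (pderivE N) h x = (-1) ^ l.length * mfactE N α * ∫ x, h x := by
  induction l generalizing α with
  | nil =>
    have : α = 0 := by ext k; simpa using (hl k).symm
    simp [this, mpowE, mfactE]
  | cons i l ih =>
    have hi : α i = l.count i + 1 := by rw [← hl i]; simp
    have hle := sum_update_pred_le α i
    rw [List.foldr_cons,
      integral_mpowE_mul_pderivE (DecayCD.foldr_pderivE (n := 1) l (by simpa using hh)) hα i,
      ih (hh.of_le (by simp))]
    · have : mfactE N α = α i * mfactE N (Function.update α i (α i - 1)) := by
        rw [mfactE, mfactE, ← Finset.mul_prod_erase Finset.univ _ (Finset.mem_univ i),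
          ← Finset.mul_prod_erase Finset.univ (fun k => (Function.update α i (α i - 1) k).factorial)
            (Finset.mem_univ i), ← mul_assoc]
        congr 1
        · simp [hi, Nat.factorial_succ]
        · refine Finset.prod_congr rfl fun k hk => ?_
          rw [Function.update_of_ne (Finset.ne_of_mem_erase hk)]
      rw [this, List.length_cons, pow_succ]
      push_cast
      ring
    · have : ((∑ k, Function.update α i (α i - 1) k : ℕ) : ℝ) ≤ (∑ i, α i : ℕ) := by
        exact_mod_cast hle
      linarith
    · intro k
      rcases eq_or_ne k i with rfl | hki
      · simp [hi]
      · rw [Function.update_of_ne hki, ← hl k]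
        simp [hki.symm]

end MultiIndex

section TaylorRemainder

/-- The remainder of the Taylor expansion of `z ↦ h (x - z)` at order `m`. -/
noncomputable def taylorRem {E : Type*} [NormedAddCommGroup E] [NormedSpace ℝ E] (m : ℕ) (h : E → ℝ)
    (x z : E) : ℝ :=
  h (x - z) - ∑ k ∈ Finset.range (m + 1), (k.factorial : ℝ)⁻¹ • iteratedFDeriv ℝ k h x fun _ => -z

theorem one_add_norm_rpow_neg_le {E : Type*} [NormedAddCommGroup E] {x w : E} {r : ℝ} (hr : 0 ≤ r)
    (hw : ‖w‖ ≤ 1) :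
    (1 + ‖x + w‖) ^ (-r) ≤ 2 ^ r * (1 + ‖x‖) ^ (-r) := by
  have h1 : 1 + ‖x‖ ≤ 2 * (1 + ‖x + w‖) := by
    have h2 : ‖x‖ ≤ ‖x + w‖ + ‖w‖ := by simpa using norm_sub_le (x + w) w
    have := norm_nonneg (x + w)
    linarith
  have h3 : (1 + ‖x‖) ^ r ≤ 2 ^ r * (1 + ‖x + w‖) ^ r := by
    rw [← Real.mul_rpow (by norm_num) (by positivity)]
    gcongr
  rw [Real.rpow_neg (by positivity), Real.rpow_neg (by positivity), ← div_eq_mul_inv,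
    le_div_iff₀ (by positivity), inv_mul_le_iff₀ (by positivity), mul_comm]
  exact h3

theorem one_add_norm_rpow_le_mul {E : Type*} [NormedAddCommGroup E] {x z : E} {K : ℝ} (hK : 0 ≤ K) :
    (1 + ‖x‖) ^ K ≤ (1 + ‖z‖) ^ K * (1 + ‖x - z‖) ^ K := by
  rw [← Real.mul_rpow (by positivity) (by positivity)]
  have : ‖x‖ ≤ ‖x - z‖ + ‖z‖ := by simpa using norm_add_le (x - z) z
  gcongr
  nlinarith [norm_nonneg z, norm_nonneg (x - z), mul_nonneg (norm_nonneg z) (norm_nonneg (x - z))]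

variable {E : Type*} [NormedAddCommGroup E] [NormedSpace ℝ E]

theorem abs_iteratedFDeriv_neg_le (h : E → ℝ) (k : ℕ) (x z : E) :
    |iteratedFDeriv ℝ k h x fun _ => -z| ≤ ‖iteratedFDeriv ℝ k h x‖ * ‖z‖ ^ k := by
  simpa using (iteratedFDeriv ℝ k h x).le_opNorm fun _ => -z

theorem DecayCD.abs_taylorRem_le_of_norm_le_one {r : ℝ} (hr : 0 ≤ r) {m : ℕ} {h : E → ℝ}
    (hh : DecayCD r (m + 1) h) :
    ∃ C : ℝ, 0 ≤ C ∧ ∀ x z : E, ‖z‖ ≤ 1 →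
      |taylorRem m h x z| ≤ C * ‖z‖ ^ (m + 1) * (1 + ‖x‖) ^ (-r) := by
  obtain ⟨C, hC0, hC⟩ := hh.norm_le_rpow (le_refl (m + 1))
  refine ⟨C * 2 ^ r, by positivity, fun x z hz => ?_⟩
  have h1 := map_add_eq_sum_add_integral_iteratedFDeriv (f := h) (n := m) (x := x) (y := -z)
    fun t _ => hh.1.contDiffAt
  rw [taylorRem, sub_eq_add_neg x z, h1, add_sub_cancel_left, smul_eq_mul, abs_mul]
  have h2 : |((m.factorial : ℝ))⁻¹| ≤ 1 := by
    rw [abs_of_nonneg (by positivity)]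
    exact inv_le_one_of_one_le₀ (by exact_mod_cast Nat.factorial_pos m)
  have h3 : ‖∫ t in (0 : ℝ)..1, (1 - t) ^ m • iteratedFDeriv ℝ (m + 1) h (x + t • -z) fun _ => -z‖
      ≤ C * 2 ^ r * ‖z‖ ^ (m + 1) * (1 + ‖x‖) ^ (-r) * |1 - 0| := by
    refine intervalIntegral.norm_integral_le_of_norm_le_const fun t ht => ?_
    rw [Set.uIoc_of_le zero_le_one] at ht
    have ht1 : |1 - t| ≤ 1 := by rw [abs_of_nonneg (by linarith [ht.2])]; linarith [ht.1]
    have hw : ‖t • -z‖ ≤ 1 := by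
      rw [norm_smul, norm_neg, Real.norm_eq_abs, abs_of_pos ht.1]
      exact mul_le_one₀ ht.2 (norm_nonneg _) hz
    rw [norm_smul, norm_pow, Real.norm_eq_abs, Real.norm_eq_abs]
    calc _ ≤ 1 * (‖iteratedFDeriv ℝ (m + 1) h (x + t • -z)‖ * ‖z‖ ^ (m + 1)) := by
          gcongr
          · exact pow_le_one₀ (abs_nonneg _) ht1
          · exact abs_iteratedFDeriv_neg_le h _ _ _
      _ ≤ 1 * (C * (2 ^ r * (1 + ‖x‖) ^ (-r)) * ‖z‖ ^ (m + 1)) := by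
          gcongr
          exact (hC _).trans (by gcongr; exact one_add_norm_rpow_neg_le hr hw)
      _ = _ := by ring
  rw [sub_zero, abs_one, mul_one] at h3
  calc _ ≤ 1 * (C * 2 ^ r * ‖z‖ ^ (m + 1) * (1 + ‖x‖) ^ (-r)) := by
        gcongr
        exact h3
    _ = _ := one_mul _

theorem DecayCD.abs_taylorRem_le_of_one_le_norm {r : ℝ} {m : ℕ} {h : E → ℝ}
    (hh : DecayCD r m h) {K : ℝ} (hmK : (m : ℝ) ≤ K) :
    ∃ C : ℝ, 0 ≤ C ∧ ∀ x z : E, 1 ≤ ‖z‖ →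
      (1 + ‖x‖) ^ K * |taylorRem m h x z| ≤
        C * ‖z‖ ^ K * ((1 + ‖x - z‖) ^ (-(r - K)) + (1 + ‖x‖) ^ (-(r - K))) := by
  have hK : 0 ≤ K := (Nat.cast_nonneg m).trans hmK
  choose! C hC0 hC using fun i (hi : i ≤ m) => hh.norm_le_rpow hi
  have hS : 0 ≤ ∑ k ∈ Finset.range (m + 1), C k :=
    Finset.sum_nonneg fun k hk => hC0 k (Finset.mem_range_succ_iff.1 hk)
  have hC00 := hC0 0 (Nat.zero_le m)
  refine ⟨2 ^ K * C 0 + ∑ k ∈ Finset.range (m + 1), C k, by positivity, fun x z hz => ?_⟩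
  have hexp : ∀ y : E, (1 + ‖y‖) ^ (-(r - K)) = (1 + ‖y‖) ^ K * (1 + ‖y‖) ^ (-r) := fun y => by
    rw [← Real.rpow_add (by positivity)]; ring_nf
  have h1 : (1 + ‖x‖) ^ K * |h (x - z)| ≤ 2 ^ K * C 0 * ‖z‖ ^ K * (1 + ‖x - z‖) ^ (-(r - K)) := by
    have := hC 0 (Nat.zero_le m) (x - z)
    rw [norm_iteratedFDeriv_zero, Real.norm_eq_abs] at this
    calc _ ≤ ((1 + ‖z‖) ^ K * (1 + ‖x - z‖) ^ K) * (C 0 * (1 + ‖x - z‖) ^ (-r)) := by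
          gcongr
          exact one_add_norm_rpow_le_mul hK
      _ ≤ ((2 * ‖z‖) ^ K * (1 + ‖x - z‖) ^ K) * (C 0 * (1 + ‖x - z‖) ^ (-r)) := by
          gcongr
          linarith
      _ = _ := by rw [Real.mul_rpow (by norm_num) (by positivity), hexp]; ring
  have h2 : ∀ k ∈ Finset.range (m + 1),
      (1 + ‖x‖) ^ K * |(k.factorial : ℝ)⁻¹ • iteratedFDeriv ℝ k h x fun _ => -z| ≤
        C k * (‖z‖ ^ K * (1 + ‖x‖) ^ (-(r - K))) := fun k hk => by
    have hk' := Finset.mem_range_succ_iff.1 hk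
    have hCk := hC0 k hk'
    have h3 : |(k.factorial : ℝ)⁻¹| ≤ 1 := by
      rw [abs_of_nonneg (by positivity)]
      exact inv_le_one_of_one_le₀ (by exact_mod_cast Nat.factorial_pos k)
    have h4 : ‖z‖ ^ k ≤ ‖z‖ ^ K := by
      rw [← Real.rpow_natCast]
      exact Real.rpow_le_rpow_of_exponent_le hz
        ((Nat.cast_le.2 hk').trans hmK)
    rw [smul_eq_mul, abs_mul]
    calc _ ≤ (1 + ‖x‖) ^ K * (1 * ((C k * (1 + ‖x‖) ^ (-r)) * ‖z‖ ^ K)) := by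
          gcongr
          refine (abs_iteratedFDeriv_neg_le h _ _ _).trans ?_
          gcongr
          exact hC k hk' x
      _ = _ := by rw [hexp]; ring
  have h5 : |taylorRem m h x z| ≤ |h (x - z)| + ∑ k ∈ Finset.range (m + 1),
      |(k.factorial : ℝ)⁻¹ • iteratedFDeriv ℝ k h x fun _ => -z| :=
    (abs_sub _ _).trans (by gcongr; exact Finset.abs_sum_le_sum_abs _ _)
  calc _ ≤ (1 + ‖x‖) ^ K * (|h (x - z)| + ∑ k ∈ Finset.range (m + 1),
      |(k.factorial : ℝ)⁻¹ • iteratedFDeriv ℝ k h x fun _ => -z|) := by gcongr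
    _ ≤ 2 ^ K * C 0 * ‖z‖ ^ K * (1 + ‖x - z‖) ^ (-(r - K)) +
        (∑ k ∈ Finset.range (m + 1), C k) * (‖z‖ ^ K * (1 + ‖x‖) ^ (-(r - K))) := by
      rw [mul_add, Finset.mul_sum, Finset.sum_mul]
      exact add_le_add h1 (Finset.sum_le_sum h2)
    _ ≤ _ := by
      have e1 : 0 ≤ 2 ^ K * C 0 * (‖z‖ ^ K * (1 + ‖x‖) ^ (-(r - K))) := by positivity
      have e2 : 0 ≤ (∑ k ∈ Finset.range (m + 1), C k) *
        (‖z‖ ^ K * (1 + ‖x - z‖) ^ (-(r - K))) := by positivity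
      linarith

theorem continuous_taylorRem {m : ℕ} {h : E → ℝ} (hh : ContDiff ℝ m h) :
    Continuous fun p : E × E => taylorRem m h p.1 p.2 := by
  unfold taylorRem
  have h0 := hh.continuous
  refine (by fun_prop : Continuous fun p : E × E => h (p.1 - p.2)).sub
    (continuous_finsetSum _ fun k hk => ?_)
  have h1 : Continuous (iteratedFDeriv ℝ k h) :=
    hh.continuous_iteratedFDeriv (by exact_mod_cast Finset.mem_range_succ_iff.1 hk)
  have h2 : Continuous fun p : E × E => iteratedFDeriv ℝ k h p.1 fun _ => -p.2 := by fun_prop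
  exact h2.const_smul (k.factorial : ℝ)⁻¹

variable [FiniteDimensional ℝ E] [MeasurableSpace E] [BorelSpace E]

theorem DecayCD.lintegral_taylorRem_le {μ : Measure E} [μ.IsAddHaarMeasure] {r : ℝ} {m : ℕ}
    {h : E → ℝ} (hh : DecayCD r (m + 1) h) {K : ℝ} (hmK : (m : ℝ) ≤ K) (hKm : K ≤ m + 1)
    (hr : Module.finrank ℝ E + K < r) :
    ∃ C : ℝ≥0∞, C ≠ ∞ ∧ ∀ z : E,
      ∫⁻ x, ENNReal.ofReal ((1 + ‖x‖) ^ K * |taylorRem m h x z|) ∂μ ≤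
        C * ENNReal.ofReal (min (‖z‖ ^ (m + 1)) (‖z‖ ^ K)) := by
  have hK : 0 ≤ K := (Nat.cast_nonneg m).trans hmK
  have hr0 : 0 ≤ r := by
    have : (0 : ℝ) ≤ Module.finrank ℝ E := Nat.cast_nonneg _
    linarith
  obtain ⟨C₁, hC₁0, hC₁⟩ := hh.abs_taylorRem_le_of_norm_le_one hr0
  obtain ⟨C₂, hC₂0, hC₂⟩ := (hh.of_le (Nat.le_succ m)).abs_taylorRem_le_of_one_le_norm hmK
  set A : ℝ≥0∞ := ∫⁻ x : E, ENNReal.ofReal ((1 + ‖x‖) ^ (-(r - K))) ∂μ with hA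
  have hAfin : A ≠ ∞ := (finite_integral_one_add_norm (by linarith)).ne
  refine ⟨ENNReal.ofReal C₁ * A + ENNReal.ofReal C₂ * (A + A), by finiteness, fun z => ?_⟩
  rcases le_total ‖z‖ 1 with hz | hz
  · have hmin : ‖z‖ ^ (m + 1) ≤ min (‖z‖ ^ (m + 1)) (‖z‖ ^ K) := by
      refine le_min le_rfl ?_
      rcases (norm_nonneg z).eq_or_lt with h0 | h0
      · rw [← h0, zero_pow (Nat.succ_ne_zero m)]
        positivity
      · rw [← Real.rpow_natCast]
        exact Real.rpow_le_rpow_of_exponent_ge h0 hz (by push_cast; exact hKm)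
    calc _ ≤ ∫⁻ x : E, ENNReal.ofReal (C₁ * ‖z‖ ^ (m + 1)) *
          ENNReal.ofReal ((1 + ‖x‖) ^ (-(r - K))) ∂μ := by
          refine lintegral_mono fun x => ?_
          rw [← ENNReal.ofReal_mul (by positivity)]
          refine ENNReal.ofReal_le_ofReal ?_
          calc _ ≤ (1 + ‖x‖) ^ K * (C₁ * ‖z‖ ^ (m + 1) * (1 + ‖x‖) ^ (-r)) := by
                gcongr
                exact hC₁ x z hz
            _ = C₁ * ‖z‖ ^ (m + 1) * ((1 + ‖x‖) ^ K * (1 + ‖x‖) ^ (-r)) := by ring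
            _ = _ := by rw [← Real.rpow_add (by positivity)]; ring_nf
      _ = ENNReal.ofReal C₁ * A * ENNReal.ofReal (‖z‖ ^ (m + 1)) := by
          rw [lintegral_const_mul' _ _ ENNReal.ofReal_ne_top, ENNReal.ofReal_mul hC₁0, ← hA]
          ring
      _ ≤ _ := by
          gcongr
          exact le_self_add
  · have hmin : ‖z‖ ^ K ≤ min (‖z‖ ^ (m + 1)) (‖z‖ ^ K) := by
      refine le_min ?_ le_rfl
      rw [← Real.rpow_natCast]
      exact Real.rpow_le_rpow_of_exponent_le hz (by push_cast; exact hKm)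
    calc _ ≤ ∫⁻ x : E, ENNReal.ofReal (C₂ * ‖z‖ ^ K) *
          (ENNReal.ofReal ((1 + ‖x - z‖) ^ (-(r - K))) +
            ENNReal.ofReal ((1 + ‖x‖) ^ (-(r - K)))) ∂μ := by
          refine lintegral_mono fun x => ?_
          rw [← ENNReal.ofReal_add (by positivity) (by positivity),
            ← ENNReal.ofReal_mul (by positivity)]
          exact ENNReal.ofReal_le_ofReal (hC₂ x z hz)
      _ = ENNReal.ofReal C₂ * (A + A) * ENNReal.ofReal (‖z‖ ^ K) := by
          rw [lintegral_const_mul' _ _ ENNReal.ofReal_ne_top, ENNReal.ofReal_mul hC₂0,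
            lintegral_add_right _ (by fun_prop),
            lintegral_sub_right_eq_self (fun x => ENNReal.ofReal ((1 + ‖x‖) ^ (-(r - K)))) z, ← hA]
          ring
      _ ≤ _ := by
          gcongr
          exact le_add_self

end TaylorRemainder

section VanishingMoments

variable {N : ℕ}

theorem prod_apply_eq_mpowE {k : ℕ} (s : Fin k → Fin N) (y : EuclideanSpace ℝ (Fin N)) :
    ∏ i, y (s i) = mpowE N (fun b => (Finset.univ.filter fun i => s i = b).card) y := by
  rw [mpowE, ← Finset.prod_fiberwise (s := Finset.univ) (g := s)]
  refine Finset.prod_congr rfl fun b _ => ?_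
  rw [Finset.prod_congr rfl fun i hi => by rw [(Finset.mem_filter.1 hi).2], Finset.prod_const]

theorem sum_card_fiber {k : ℕ} (s : Fin k → Fin N) :
    ∑ b, (Finset.univ.filter fun i => s i = b).card = k := by
  simpa using (Finset.card_eq_sum_card_fiberwise (s := Finset.univ) (t := Finset.univ) (f := s)
    (fun _ _ => Finset.mem_univ _)).symm

theorem map_diag_eq_sum_mpowE {k : ℕ}
    (T : ContinuousMultilinearMap ℝ (fun _ : Fin k => EuclideanSpace ℝ (Fin N)) ℝ)
    (y : EuclideanSpace ℝ (Fin N)) :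
    T (fun _ => y) = ∑ s : Fin k → Fin N,
      mpowE N (fun b => (Finset.univ.filter fun i => s i = b).card) y *
        T fun i => EuclideanSpace.single (s i) 1 := by
  have hy : y = ∑ b, y b • EuclideanSpace.single b (1 : ℝ) := by
    simpa using ((EuclideanSpace.basisFun (Fin N) ℝ).sum_repr y).symm
  conv_lhs => rw [hy]
  rw [ContinuousMultilinearMap.map_sum]
  refine Finset.sum_congr rfl fun s _ => ?_
  rw [ContinuousMultilinearMap.map_smul_univ, prod_apply_eq_mpowE, smul_eq_mul]

variable {K : ℝ} {ψ : EuclideanSpace ℝ (Fin N) → ℝ}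

theorem integrable_of_integrable_weight (hK : 0 ≤ K)
    (hψ : Integrable fun y => (1 + ‖y‖) ^ K * ψ y) : Integrable ψ := by
  have h1 : ψ = fun y => (1 + ‖y‖) ^ (-K) * ((1 + ‖y‖) ^ K * ψ y) := by
    ext y
    rw [← mul_assoc, ← Real.rpow_add (by positivity), neg_add_cancel, Real.rpow_zero, one_mul]
  have hm : AEStronglyMeasurable ψ := by
    rw [h1]
    exact (by fun_prop : Measurable fun y : EuclideanSpace ℝ (Fin N) =>
      (1 + ‖y‖) ^ (-K)).aestronglyMeasurable.mul hψ.aestronglyMeasurable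
  refine hψ.mono hm (ae_of_all _ fun y => ?_)
  rw [norm_mul]
  refine le_mul_of_one_le_left (norm_nonneg _) ?_
  rw [Real.norm_of_nonneg (by positivity)]
  exact Real.one_le_rpow (by linarith [norm_nonneg y]) hK

theorem integrable_mpowE_mul_of_weight (hψ : Integrable fun y => (1 + ‖y‖) ^ K * ψ y)
    {α : Fin N → ℕ} (hα : ((∑ i, α i : ℕ) : ℝ) ≤ K) : Integrable fun y => mpowE N α y * ψ y := by
  have hψ' := integrable_of_integrable_weight ((Nat.cast_nonneg _).trans hα) hψ
  refine hψ.mono ((contDiff_mpowE α (n := 0)).continuous.aestronglyMeasurable.mul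
    hψ'.aestronglyMeasurable) (ae_of_all _ fun y => ?_)
  rw [norm_mul, norm_mul, Real.norm_eq_abs (mpowE N α y),
    Real.norm_of_nonneg (by positivity : 0 ≤ (1 + ‖y‖) ^ K)]
  gcongr
  refine (abs_mpowE_le α y).trans (Real.rpow_le_rpow_of_exponent_le ?_ hα)
  linarith [norm_nonneg y]

theorem integrable_mul_map_diag {k : ℕ} (hk : (k : ℝ) ≤ K)
    (hψ : Integrable fun y => (1 + ‖y‖) ^ K * ψ y)
    (T : ContinuousMultilinearMap ℝ (fun _ : Fin k => EuclideanSpace ℝ (Fin N)) ℝ) :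
    Integrable fun y => ψ y * T fun _ => y := by
  simp_rw [map_diag_eq_sum_mpowE T, Finset.mul_sum]
  refine integrable_finsetSum _ fun s _ => ?_
  have := (integrable_mpowE_mul_of_weight (α := fun b => (Finset.univ.filter fun i => s i = b).card)
    hψ (by rw [sum_card_fiber]; exact hk)).mul_const (T fun i => EuclideanSpace.single (s i) 1)
  refine this.congr (ae_of_all _ fun y => ?_)
  ring

theorem integral_mul_map_diag_eq_zero {k : ℕ} (hk : (k : ℝ) ≤ K)
    (hψ : Integrable fun y => (1 + ‖y‖) ^ K * ψ y)
    (hmom : ∀ α : Fin N → ℕ, ((∑ i, α i : ℕ) : ℝ) ≤ K → momE N α ψ = 0)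
    (T : ContinuousMultilinearMap ℝ (fun _ : Fin k => EuclideanSpace ℝ (Fin N)) ℝ) :
    ∫ y, ψ y * T (fun _ => y) = 0 := by
  have hs : ∀ s : Fin k → Fin N,
      ((∑ b, (Finset.univ.filter fun i => s i = b).card : ℕ) : ℝ) ≤ K := fun s => by
    rw [sum_card_fiber]; exact hk
  have h1 : ∀ y, ψ y * T (fun _ => y) = ∑ s : Fin k → Fin N,
      (mpowE N (fun b => (Finset.univ.filter fun i => s i = b).card) y * ψ y) *
        T fun i => EuclideanSpace.single (s i) 1 := fun y => by
    rw [map_diag_eq_sum_mpowE T, Finset.mul_sum]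
    exact Finset.sum_congr rfl fun s _ => by ring
  simp_rw [h1]
  rw [integral_finsetSum _ fun s _ =>
    (integrable_mpowE_mul_of_weight hψ (hs s)).mul_const _]
  refine Finset.sum_eq_zero fun s _ => ?_
  rw [integral_mul_const]
  have := hmom _ (hs s)
  rw [momE] at this
  rw [this, zero_mul]

theorem integral_smul_comp_sub_eq_integral_taylorRem {r : ℝ} (hr : 0 ≤ r) {m : ℕ}
    {h : EuclideanSpace ℝ (Fin N) → ℝ} (hh : DecayCD r m h) (hmK : (m : ℝ) ≤ K)
    (hψ : Integrable fun y => (1 + ‖y‖) ^ K * ψ y)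
    (hmom : ∀ α : Fin N → ℕ, ((∑ i, α i : ℕ) : ℝ) ≤ K → momE N α ψ = 0)
    (a : ℝ) (x : EuclideanSpace ℝ (Fin N)) :
    ∫ y, ψ y • h (x - a • y) = ∫ y, ψ y * taylorRem m h x (a • y) := by
  have hψ' := integrable_of_integrable_weight ((Nat.cast_nonneg m).trans hmK) hψ
  obtain ⟨C, hC0, hC⟩ := hh.norm_le_rpow (Nat.zero_le m)
  have hcont := hh.1.continuous
  have hi : Integrable fun y => ψ y • h (x - a • y) := by
    refine hψ'.smul_bdd C (by fun_prop : Continuous fun y => h (x - a • y)).aestronglyMeasurable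
      (ae_of_all _ fun y => ?_)
    have := hC (x - a • y)
    rw [norm_iteratedFDeriv_zero] at this
    refine this.trans (mul_le_of_le_one_right hC0 ?_)
    exact Real.rpow_le_one_of_one_le_of_nonpos (by linarith [norm_nonneg (x - a • y)])
      (by linarith)
  have hneg : ∀ (k : ℕ) (y : EuclideanSpace ℝ (Fin N)),
      ψ y * ((k.factorial : ℝ)⁻¹ • iteratedFDeriv ℝ k h x fun _ => -(a • y)) =
        ((k.factorial : ℝ)⁻¹ * (-a) ^ k) * (ψ y * iteratedFDeriv ℝ k h x fun _ => y) :=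
    fun k y => by
      have := (iteratedFDeriv ℝ k h x).map_smul_univ (fun _ => -a) fun _ => y
      simp only [neg_smul, Finset.prod_const, Finset.card_univ, Fintype.card_fin] at this
      rw [this, smul_eq_mul, smul_eq_mul]
      ring
  have hkK : ∀ k ∈ Finset.range (m + 1), (k : ℝ) ≤ K := fun k hk =>
    (Nat.cast_le.2 (Finset.mem_range_succ_iff.1 hk)).trans hmK
  have hT : ∀ k ∈ Finset.range (m + 1), Integrable fun y =>
      ψ y * ((k.factorial : ℝ)⁻¹ • iteratedFDeriv ℝ k h x fun _ => -(a • y)) := fun k hk => by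
    simp_rw [hneg]
    exact (integrable_mul_map_diag (hkK k hk) hψ _).const_mul _
  simp_rw [taylorRem, mul_sub, Finset.mul_sum]
  rw [integral_sub (by simpa using hi) (integrable_finsetSum _ hT), integral_finsetSum _ hT,
    Finset.sum_eq_zero, sub_zero]
  · simp
  · intro k hk
    simp_rw [hneg]
    rw [integral_const_mul, integral_mul_map_diag_eq_zero (hkK k hk) hψ hmom, mul_zero]

theorem tendsto_rpow_mul_lintegral_weight {r : ℝ} {m : ℕ} {h : EuclideanSpace ℝ (Fin N) → ℝ}
    (hh : DecayCD r (m + 1) h) (hmK : (m : ℝ) ≤ K) (hKm : K < m + 1) (hr : N + K < r)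
    (hψ : Integrable fun y => (1 + ‖y‖) ^ K * ψ y)
    (hmom : ∀ α : Fin N → ℕ, ((∑ i, α i : ℕ) : ℝ) ≤ K → momE N α ψ = 0) :
    Tendsto (fun a : ℝ => ENNReal.ofReal (a ^ K) *
      ∫⁻ x, ENNReal.ofReal ((1 + ‖x‖) ^ K) * ‖∫ y, ψ y • h (x - a⁻¹ • y)‖ₑ) atTop (𝓝 0) := by
  have hK : 0 ≤ K := (Nat.cast_nonneg m).trans hmK
  have hr0 : 0 ≤ r := by
    have : (0 : ℝ) ≤ N := Nat.cast_nonneg _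
    linarith
  have hψ' := integrable_of_integrable_weight hK hψ
  have hψm : AEMeasurable ψ := hψ'.aestronglyMeasurable.aemeasurable
  have hhm := hh.of_le (Nat.le_succ m)
  obtain ⟨C, hCfin, hC⟩ := hh.lintegral_taylorRem_le (μ := volume) hmK hKm.le
    (by rw [finrank_euclideanSpace_fin]; exact hr)
  have hbound : ∀ a : ℝ, ∫⁻ x, ENNReal.ofReal ((1 + ‖x‖) ^ K) *
      ‖∫ y, ψ y • h (x - a⁻¹ • y)‖ₑ ≤
        ∫⁻ y, ‖ψ y‖ₑ * (C * ENNReal.ofReal (min (‖a⁻¹ • y‖ ^ (m + 1)) (‖a⁻¹ • y‖ ^ K))) := by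
    intro a
    calc _ ≤ ∫⁻ x, ∫⁻ y, ‖ψ y‖ₑ *
          ENNReal.ofReal ((1 + ‖x‖) ^ K * |taylorRem m h x (a⁻¹ • y)|) := by
          refine lintegral_mono fun x => ?_
          rw [integral_smul_comp_sub_eq_integral_taylorRem hr0 hhm hmK hψ hmom]
          calc _ ≤ ENNReal.ofReal ((1 + ‖x‖) ^ K) *
                ∫⁻ y, ‖ψ y * taylorRem m h x (a⁻¹ • y)‖ₑ := by
                gcongr
                exact enorm_integral_le_lintegral_enorm _
            _ = _ := by
                rw [← lintegral_const_mul' _ _ ENNReal.ofReal_ne_top]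
                refine lintegral_congr fun y => ?_
                rw [enorm_mul, ENNReal.ofReal_mul (by positivity),
                  Real.enorm_eq_ofReal_abs (taylorRem _ _ _ _)]
                ring
      _ = ∫⁻ y, ∫⁻ x, ‖ψ y‖ₑ *
          ENNReal.ofReal ((1 + ‖x‖) ^ K * |taylorRem m h x (a⁻¹ • y)|) := by
          refine lintegral_lintegral_swap ?_
          have h1 : Continuous fun p : EuclideanSpace ℝ (Fin N) × EuclideanSpace ℝ (Fin N) =>
              taylorRem m h p.1 (a⁻¹ • p.2) :=
            (continuous_taylorRem hhm.1).comp
              (by fun_prop : Continuous fun p : EuclideanSpace ℝ (Fin N) ×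
                EuclideanSpace ℝ (Fin N) => (p.1, a⁻¹ • p.2))
          have h2 : Measurable fun p : EuclideanSpace ℝ (Fin N) × EuclideanSpace ℝ (Fin N) =>
              ENNReal.ofReal ((1 + ‖p.1‖) ^ K * |taylorRem m h p.1 (a⁻¹ • p.2)|) := by
            have := h1.measurable
            fun_prop
          exact (hψm.comp_snd.enorm).mul h2.aemeasurable
      _ ≤ _ := by
          refine lintegral_mono fun y => ?_
          rw [lintegral_const_mul' _ _ (by finiteness)]
          gcongr
          exact hC _
  have hlim : Tendsto (fun a : ℝ => ∫⁻ y, ENNReal.ofReal (a ^ K) * (‖ψ y‖ₑ *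
      (C * ENNReal.ofReal (min (‖a⁻¹ • y‖ ^ (m + 1)) (‖a⁻¹ • y‖ ^ K))))) atTop
      (𝓝 (∫⁻ _ : EuclideanSpace ℝ (Fin N), 0)) := by
    refine tendsto_lintegral_filter_of_dominated_convergence'
      (fun y => ‖ψ y‖ₑ * (C * ENNReal.ofReal ((1 + ‖y‖) ^ K))) ?_ ?_ ?_ ?_
    · exact Eventually.of_forall fun a => by fun_prop
    · filter_upwards [eventually_gt_atTop 0] with a ha
      refine ae_of_all _ fun y => ?_
      have : a ^ K * min (‖a⁻¹ • y‖ ^ (m + 1)) (‖a⁻¹ • y‖ ^ K) ≤ (1 + ‖y‖) ^ K := by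
        calc _ ≤ a ^ K * ‖a⁻¹ • y‖ ^ K := by gcongr; exact min_le_right _ _
          _ = ‖y‖ ^ K := by
            rw [← Real.mul_rpow ha.le (norm_nonneg _), norm_smul, norm_inv,
              Real.norm_of_nonneg ha.le, mul_inv_cancel_left₀ ha.ne']
          _ ≤ _ := by gcongr; linarith
      calc _ = ‖ψ y‖ₑ * (C * ENNReal.ofReal
            (a ^ K * min (‖a⁻¹ • y‖ ^ (m + 1)) (‖a⁻¹ • y‖ ^ K))) := by
            rw [ENNReal.ofReal_mul (by positivity)]; ring
        _ ≤ _ := by gcongr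
    · have h1 : ∫⁻ y, ‖(1 + ‖y‖) ^ K * ψ y‖ₑ < ∞ := hψ.2
      have h2 : ∫⁻ y, ‖ψ y‖ₑ * (C * ENNReal.ofReal ((1 + ‖y‖) ^ K)) =
          C * ∫⁻ y, ‖(1 + ‖y‖) ^ K * ψ y‖ₑ := by
        rw [← lintegral_const_mul' _ _ hCfin]
        refine lintegral_congr fun y => ?_
        rw [enorm_mul, Real.enorm_of_nonneg (by positivity : 0 ≤ (1 + ‖y‖) ^ K)]
        ring
      rw [h2]
      finiteness
    · refine ae_of_all _ fun y => ?_
      have h1 : Tendsto (fun a : ℝ => a ^ (K - (m + 1)) * ‖y‖ ^ (m + 1)) atTop (𝓝 0) := by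
        have := (tendsto_rpow_neg_atTop (y := m + 1 - K) (by linarith)).mul_const (‖y‖ ^ (m + 1))
        simpa using this
      have h2 : Tendsto (fun a : ℝ => ‖ψ y‖ₑ * (C * ENNReal.ofReal
          (a ^ (K - (m + 1)) * ‖y‖ ^ (m + 1)))) atTop (𝓝 0) := by
        have h3 := ENNReal.tendsto_ofReal h1
        have h4 := ENNReal.Tendsto.const_mul (ENNReal.Tendsto.const_mul h3 (a := C)
          (Or.inr hCfin)) (a := ‖ψ y‖ₑ) (Or.inr enorm_ne_top)
        simpa using h4
      refine tendsto_of_tendsto_of_tendsto_of_le_of_le' tendsto_const_nhds h2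
        (Eventually.of_forall fun _ => zero_le) ?_
      filter_upwards [eventually_gt_atTop 0] with a ha
      have : a ^ K * min (‖a⁻¹ • y‖ ^ (m + 1)) (‖a⁻¹ • y‖ ^ K) ≤
          a ^ (K - (m + 1)) * ‖y‖ ^ (m + 1) := by
        calc _ ≤ a ^ K * ‖a⁻¹ • y‖ ^ (m + 1) := by gcongr; exact min_le_left _ _
          _ = _ := by
            rw [norm_smul, norm_inv, Real.norm_of_nonneg ha.le, mul_pow, Real.rpow_sub ha,
              ← Nat.cast_succ, Real.rpow_natCast, inv_pow]
            field_simp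
      calc _ = ‖ψ y‖ₑ * (C * ENNReal.ofReal
            (a ^ K * min (‖a⁻¹ • y‖ ^ (m + 1)) (‖a⁻¹ • y‖ ^ K))) := by
            rw [ENNReal.ofReal_mul (by positivity)]; ring
        _ ≤ _ := by gcongr
  rw [lintegral_zero] at hlim
  refine tendsto_of_tendsto_of_tendsto_of_le_of_le tendsto_const_nhds hlim
    (fun _ => zero_le) fun a => ?_
  simp only
  rw [lintegral_const_mul' _ _ ENNReal.ofReal_ne_top]
  exact mul_le_mul_right (hbound a) _

end VanishingMoments

section Kernel

variable {N γ : ℕ} {d L : ℝ} {G : EuclideanSpace ℝ (Fin N) → ℝ → ℝ}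

theorem CondG.apply_rpow (hG : CondG N G γ d L) (hd : 0 < d) {a : ℝ} (ha : 0 < a)
    (x : EuclideanSpace ℝ (Fin N)) : G x (a ^ d) = (a ^ N)⁻¹ * G (a⁻¹ • x) 1 := by
  rw [hG.scaling x (a ^ d) (by positivity), ← Real.rpow_mul ha.le, ← Real.rpow_mul ha.le,
    mul_div_cancel₀ _ hd.ne', mul_div_cancel₀ _ hd.ne', Real.rpow_neg ha.le, Real.rpow_natCast,
    Real.rpow_neg_one]

theorem CondG.contDiff (hG : CondG N G γ d L) {t : ℝ} (ht : 0 < t) :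
    ContDiff ℝ γ fun x => G x t := by
  rw [← contDiffOn_univ]
  exact hG.smooth.comp (f := fun x : EuclideanSpace ℝ (Fin N) => (x, t)) (by fun_prop)
    fun _ _ => ht

theorem CondG.decayCD (hG : CondG N G γ d L) : DecayCD (N + L) γ fun x => G x 1 := by
  refine ⟨hG.contDiff one_pos, fun i hi => ?_⟩
  obtain ⟨C, hC⟩ := hG.decay i hi
  refine ⟨C, fun x => le_trans ?_ (hC x)⟩
  exact mul_le_mul_of_nonneg_right (Real.rpow_le_rpow_of_exponent_le
    (by linarith [norm_nonneg x]) (by linarith [(Nat.cast_nonneg i : (0 : ℝ) ≤ i)])) (norm_nonneg _)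

theorem CondG.norm_iteratedFDeriv_le (hG : CondG N G γ d L) (hd : 0 < d) {j : ℕ} (hj : j ≤ γ) :
    ∃ C : ℝ, 0 ≤ C ∧ ∀ a : ℝ, 0 < a → ∀ x,
      ‖iteratedFDeriv ℝ j (fun y => G y (a ^ d)) x‖ ≤
        (a ^ (N + j))⁻¹ * (C * (1 + ‖a⁻¹ • x‖) ^ (-(N + L))) := by
  obtain ⟨C, hC0, hC⟩ := hG.decayCD.norm_le_rpow hj
  refine ⟨C, hC0, fun a ha x => ?_⟩
  have hj' : ((j : ℕ) : WithTop ℕ∞) ≤ γ := by exact_mod_cast hj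
  have h1 : ContDiff ℝ j fun y => G y 1 := (hG.contDiff one_pos).of_le hj'
  have h2 : ContDiff ℝ j fun y => G (a⁻¹ • y) 1 := h1.comp (by fun_prop)
  have h3 : (fun y => G y (a ^ d)) = fun y => (a ^ N)⁻¹ • G (a⁻¹ • y) 1 := by
    ext y
    rw [hG.apply_rpow hd ha, smul_eq_mul]
  rw [h3, iteratedFDeriv_const_smul_apply' h2.contDiffAt, iteratedFDeriv_comp_const_smul a⁻¹ h1,
    norm_smul, norm_smul, Real.norm_of_nonneg (by positivity), Real.norm_of_nonneg (by positivity),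
    ← mul_assoc, inv_pow, ← mul_inv, ← pow_add]
  gcongr
  exact hC _

theorem CondG.exists_norm_iteratedFDeriv_le (hG : CondG N G γ d L) (hd : 0 < d) (hL : 0 < L)
    {t : ℝ} (ht : 0 < t) {j : ℕ} (hj : j ≤ γ) :
    ∃ C : ℝ, ∀ x, ‖iteratedFDeriv ℝ j (fun y => G y t) x‖ ≤ C := by
  obtain ⟨C, hC0, hC⟩ := hG.norm_iteratedFDeriv_le hd hj
  have hta : t = (t ^ d⁻¹) ^ d := by
    rw [← Real.rpow_mul ht.le, inv_mul_cancel₀ hd.ne', Real.rpow_one]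
  have ha : 0 < t ^ d⁻¹ := by positivity
  refine ⟨((t ^ d⁻¹) ^ (N + j))⁻¹ * (C * 1), fun x => ?_⟩
  have := hC _ ha x
  rw [← hta] at this
  refine this.trans ?_
  gcongr
  exact Real.rpow_le_one_of_one_le_of_nonpos (by linarith [norm_nonneg ((t ^ d⁻¹)⁻¹ • x)])
    (by linarith [(Nat.cast_nonneg N : (0 : ℝ) ≤ N)])

theorem CondG.exists_norm_le (hG : CondG N G γ d L) (hd : 0 < d) (hL : 0 < L) {t : ℝ} (ht : 0 < t) :
    ∃ C : ℝ, ∀ x, ‖G x t‖ ≤ C := by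
  simpa only [norm_iteratedFDeriv_zero] using
    hG.exists_norm_iteratedFDeriv_le hd hL ht (Nat.zero_le γ)

theorem DecayCD.integrable_weight_mul {r K : ℝ} {n : ℕ} {h : EuclideanSpace ℝ (Fin N) → ℝ}
    (hh : DecayCD r n h) (hr : N + K < r) : Integrable fun x => (1 + ‖x‖) ^ K * h x := by
  obtain ⟨C, hC0, hC⟩ := hh.norm_le_rpow (Nat.zero_le n)
  have h1 : Integrable fun x : EuclideanSpace ℝ (Fin N) => C * (1 + ‖x‖) ^ (-(r - K)) :=
    (integrable_one_add_norm (by rw [finrank_euclideanSpace_fin]; linarith)).const_mul C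
  have hm : Measurable h := hh.1.continuous.measurable
  refine h1.mono' (by fun_prop : Measurable _).aestronglyMeasurable (ae_of_all _ fun x => ?_)
  have h2 := hC x
  rw [norm_iteratedFDeriv_zero] at h2
  rw [norm_mul, Real.norm_of_nonneg (by positivity), neg_sub, sub_eq_add_neg,
    Real.rpow_add (by positivity)]
  calc _ ≤ (1 + ‖x‖) ^ K * (C * (1 + ‖x‖) ^ (-r)) := by gcongr
    _ = _ := by ring

theorem CondG.integrable (hG : CondG N G γ d L) (hd : 0 < d) (hL : 0 < L) {t : ℝ} (ht : 0 < t) :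
    Integrable fun x => G x t := by
  have h1 : Integrable fun x => G x 1 := by
    simpa using hG.decayCD.integrable_weight_mul (K := 0) (by linarith)
  have hta : t = (t ^ d⁻¹) ^ d := by
    rw [← Real.rpow_mul ht.le, inv_mul_cancel₀ hd.ne', Real.rpow_one]
  have ha : 0 < t ^ d⁻¹ := by positivity
  rw [hta]
  simp_rw [hG.apply_rpow hd ha]
  exact (h1.comp_smul (inv_ne_zero ha.ne')).const_mul _

theorem CondG.integral_mul_eq_self (hG : CondG N G γ d L) (hd : 0 < d) (hL : 0 < L)
    (x : EuclideanSpace ℝ (Fin N)) : G x 1 * ∫ y, G y 1 = G x 1 := by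
  have hint := hG.integrable hd hL one_pos
  have hcont : Continuous fun x => G x 1 := (hG.contDiff one_pos).continuous
  obtain ⟨C, hC⟩ := hG.exists_norm_le hd hL one_pos
  have h1 : ∀ a : ℝ, 0 < a → G x (1 + a ^ d) = ∫ y, G (x - a • y) 1 * G y 1 := fun a ha => by
    rw [hG.semigroup x (1 + a ^ d) (a ^ d) (by positivity) (by linarith), add_sub_cancel_right]
    simp_rw [hG.apply_rpow hd ha]
    have := Measure.integral_comp_inv_smul_of_nonneg (volume : Measure (EuclideanSpace ℝ (Fin N)))
      (fun y => G (x - a • y) 1 * G y 1) ha.le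
    simp_rw [smul_inv_smul₀ ha.ne', finrank_euclideanSpace_fin] at this
    have h2 : ∀ y, G (x - y) 1 * ((a ^ N)⁻¹ * G (a⁻¹ • y) 1) =
      (a ^ N)⁻¹ * (G (x - y) 1 * G (a⁻¹ • y) 1) := fun y => by ring
    simp_rw [h2]
    rw [integral_const_mul, this, smul_eq_mul, inv_mul_cancel_left₀ (by positivity)]
  have h2 : Tendsto (fun a : ℝ => G x (1 + a ^ d)) (𝓝[>] 0) (𝓝 (G x 1)) := by
    have hc : ContinuousAt (fun p : EuclideanSpace ℝ (Fin N) × ℝ => G p.1 p.2) (x, 1) :=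
      hG.smooth.continuousOn.continuousAt
        ((isOpen_lt continuous_const continuous_snd).mem_nhds (zero_lt_one' ℝ))
    have h3 : Tendsto (fun a : ℝ => (x, 1 + a ^ d)) (𝓝[>] 0) (𝓝 (x, 1)) := by
      have h4 : ContinuousAt (fun a : ℝ => (x, 1 + a ^ d)) 0 := by
        have : ContinuousAt (fun a : ℝ => a ^ d) 0 :=
          Real.continuousAt_rpow_const 0 d (Or.inr hd.le)
        fun_prop
      have h5 := h4.tendsto
      rw [Real.zero_rpow hd.ne', add_zero] at h5
      exact h5.mono_left nhdsWithin_le_nhds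
    exact hc.tendsto.comp h3
  have h3 : Tendsto (fun a : ℝ => ∫ y, G (x - a • y) 1 * G y 1) (𝓝[>] 0)
      (𝓝 (∫ y, G x 1 * G y 1)) := by
    refine tendsto_integral_filter_of_dominated_convergence (fun y => C * ‖G y 1‖)
      (Eventually.of_forall fun a => ?_) (Eventually.of_forall fun a => ae_of_all _ fun y => ?_)
      (hint.norm.const_mul C) (ae_of_all _ fun y => ?_)
    · have : Continuous fun y => G (x - a • y) 1 :=
        hcont.comp (by fun_prop : Continuous fun y => x - a • y)
      exact (this.mul hcont).aestronglyMeasurable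
    · rw [norm_mul]
      gcongr
      exact hC _
    · have h4 : Continuous fun a : ℝ => G (x - a • y) 1 * G y 1 :=
        (hcont.comp (by fun_prop : Continuous fun a : ℝ => x - a • y)).mul_const _
      have h5 := h4.tendsto 0
      rw [zero_smul, sub_zero] at h5
      exact h5.mono_left nhdsWithin_le_nhds
  rw [integral_const_mul] at h3
  refine tendsto_nhds_unique (h3.congr' ?_) h2
  filter_upwards [self_mem_nhdsWithin] with a ha
  exact (h1 a ha).symm

theorem CondG.integral_eq_one_or_eq_zero (hG : CondG N G γ d L) (hd : 0 < d) (hL : 0 < L) :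
    ∫ y, G y 1 = 1 ∨ ∀ x, G x 1 = 0 := by
  by_contra! h
  obtain ⟨x, hx⟩ := h.2
  exact h.1 (mul_left_cancel₀ hx ((hG.integral_mul_eq_self hd hL x).trans (mul_one _).symm))

theorem sgOp_eq_integral_smul (t : ℝ) (ψ : EuclideanSpace ℝ (Fin N) → ℝ)
    (x : EuclideanSpace ℝ (Fin N)) : sgOp N G t ψ x = ∫ y, ψ y • G (x - y) t := by
  simp only [sgOp, smul_eq_mul, mul_comm]

theorem CondG.integrable_sgOp (hG : CondG N G γ d L) (hd : 0 < d) (hL : 0 < L) {t : ℝ} (ht : 0 < t)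
    {ψ : EuclideanSpace ℝ (Fin N) → ℝ} (hψ : Integrable ψ) : Integrable (sgOp N G t ψ) := by
  have h1 := hψ.integrable_convolution (ContinuousLinearMap.mul ℝ ℝ) (hG.integrable hd hL ht)
  refine h1.congr (ae_of_all _ fun x => ?_)
  simp only [convolution_def, sgOp_eq_integral_smul, ContinuousLinearMap.mul_apply', smul_eq_mul]

theorem CondG.sgOp_sgOp (hG : CondG N G γ d L) (hd : 0 < d) (hL : 0 < L) {s t : ℝ} (hs : 0 < s)
    (ht : 0 < t) {ψ : EuclideanSpace ℝ (Fin N) → ℝ} (hψ : Integrable ψ) :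
    sgOp N G s (sgOp N G t ψ) = sgOp N G (s + t) ψ := by
  ext x
  obtain ⟨C, hC⟩ := hG.exists_norm_le hd hL hs
  have hcont : Continuous fun x => G x s := (hG.contDiff hs).continuous
  have h1 : Integrable fun p : EuclideanSpace ℝ (Fin N) × EuclideanSpace ℝ (Fin N) =>
      G (x - p.1) s * (G (p.1 - p.2) t * ψ p.2) := by
    have h2 := hψ.convolution_integrand (ContinuousLinearMap.mul ℝ ℝ) (hG.integrable hd hL ht)
    have h3 : Integrable fun p : EuclideanSpace ℝ (Fin N) × EuclideanSpace ℝ (Fin N) =>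
        G (p.1 - p.2) t * ψ p.2 :=
      h2.congr (ae_of_all _ fun p => by simp [mul_comm])
    exact h3.bdd_mul (c := C) (hcont.comp
      (by fun_prop : Continuous fun p : EuclideanSpace ℝ (Fin N) × EuclideanSpace ℝ (Fin N) =>
        x - p.1)).aestronglyMeasurable (ae_of_all _ fun p => hC _)
  calc _ = ∫ y, ∫ z, G (x - y) s * (G (y - z) t * ψ z) := by
        simp only [sgOp, integral_const_mul]
    _ = ∫ z, ∫ y, G (x - y) s * (G (y - z) t * ψ z) := integral_integral_swap h1
    _ = ∫ z, G (x - z) (s + t) * ψ z := by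
        congr 1
        ext z
        rw [hG.semigroup (x - z) (s + t) t ht (by linarith), add_sub_cancel_right,
          ← integral_mul_const,
          ← integral_sub_right_eq_self (fun y => G (x - z - y) s * G y t * ψ z) z]
        congr 1
        ext y
        rw [sub_sub_sub_cancel_right, mul_assoc]

theorem foldr_pderivE_integral_smul_comp_sub {r : ℝ} (hr : 0 ≤ r)
    {u h : EuclideanSpace ℝ (Fin N) → ℝ} (hu : Integrable u) {l : List (Fin N)}
    (hh : DecayCD r l.length h) :
    l.foldr (pderivE N) (fun x => ∫ y, u y • h (x - y)) =
      fun x => ∫ y, u y • l.foldr (pderivE N) h (x - y) := by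
  induction l with
  | nil => rfl
  | cons i l ih =>
    have hg : DecayCD r 1 (l.foldr (pderivE N) h) :=
      DecayCD.foldr_pderivE (n := 1) l (by simpa using hh)
    simp only [List.foldr_cons]
    rw [ih (hh.of_le (by simp))]
    generalize l.foldr (pderivE N) h = g at hg
    have hle : ∀ x : EuclideanSpace ℝ (Fin N), (1 + ‖x‖) ^ (-r) ≤ 1 := fun x =>
      Real.rpow_le_one_of_one_le_of_nonpos (by linarith [norm_nonneg x]) (by linarith)
    obtain ⟨C, hC0, hC⟩ := hg.norm_le_rpow (Nat.zero_le 1)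
    obtain ⟨D, hD0, hD⟩ := hg.norm_le_rpow (le_refl 1)
    have hC' : ∀ x, ‖g x‖ ≤ C := fun x => by
      simpa using (hC x).trans (mul_le_of_le_one_right hC0 (hle x))
    have hD' : ∀ x, ‖fderiv ℝ g x‖ ≤ D := fun x => by
      simpa using (hD x).trans (mul_le_of_le_one_right hD0 (hle x))
    ext x
    have hg1 : ContDiff ℝ 1 g := hg.1
    rw [pderivE, (hasFDerivAt_integral_smul_comp_sub hu hg1 hC' hD' x).fderiv,
      ContinuousLinearMap.integral_apply
        (integrable_smul_comp_sub hu (hg1.continuous_fderiv one_ne_zero) hD' x)]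
    rfl

theorem gA_zero (β : Fin N → ℕ) (x : EuclideanSpace ℝ (Fin N)) :
    gA N G β x 0 =
      ((-1 : ℝ) ^ (∑ i, β i) / (mfactE N β : ℝ)) * mderivE N β (fun y => G y 1) x := by
  simp [gA]

theorem CondG.gA_eq_sgOp (hG : CondG N G γ d L) (hd : 0 < d) (hL : 0 < L) {β : Fin N → ℕ}
    (hβ : ∑ i, β i ≤ γ) {t : ℝ} (ht : 0 < t) (x : EuclideanSpace ℝ (Fin N)) :
    gA N G β x t = sgOp N G t (fun y => gA N G β y 0) x := by
  obtain ⟨l, -, hlen, hl⟩ := exists_list_mderivE β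
  have h1 : (fun y => G y (t + 1)) = fun x => ∫ y, G y t • G (x - y) 1 := by
    ext y
    rw [hG.semigroup y (t + 1) 1 one_pos (by linarith), add_sub_cancel_right,
      ← integral_sub_left_eq_self _ volume y]
    simp
  simp_rw [gA_zero, hl, gA, hl, h1]
  have h2 := integral_sub_left_eq_self
    (fun y => G y t • l.foldr (pderivE N) (fun x => G x 1) (x - y)) volume x
  simp only [sub_sub_cancel] at h2
  rw [foldr_pderivE_integral_smul_comp_sub (by positivity : 0 ≤ (N : ℝ) + L)
    (hG.integrable hd hL ht) (hG.decayCD.of_le (hlen.trans_le hβ)), sgOp]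
  beta_reduce
  rw [← h2, ← integral_const_mul]
  simp only [smul_eq_mul]
  congr 1
  ext y
  ring

theorem CondG.decayCD_gA (hG : CondG N G γ d L) {β : Fin N → ℕ} (hβ : ∑ i, β i ≤ γ) :
    ∃ l : List (Fin N), (∀ i, l.count i = β i) ∧ l.length = ∑ i, β i ∧
      DecayCD (N + L) 0 (l.foldr (pderivE N) fun y => G y 1) ∧
      (fun y => gA N G β y 0) = fun y => ((-1 : ℝ) ^ l.length / (mfactE N β : ℝ)) *
        l.foldr (pderivE N) (fun y => G y 1) y := by
  obtain ⟨l, hcount, hlen, hl⟩ := exists_list_mderivE β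
  refine ⟨l, hcount, hlen, (hG.decayCD.of_le (by omega)).foldr_pderivE l, ?_⟩
  simp_rw [gA_zero, hl, hlen]

theorem CondG.integrable_weight_mul_gA (hG : CondG N G γ d L) {β : Fin N → ℕ} (hβ : ∑ i, β i ≤ γ)
    {K : ℝ} (hK : K < L) : Integrable fun y => (1 + ‖y‖) ^ K * gA N G β y 0 := by
  obtain ⟨l, -, -, hdec, hgA⟩ := hG.decayCD_gA hβ
  have h1 := (hdec.integrable_weight_mul (K := K) (by linarith)).const_mul
    ((-1 : ℝ) ^ l.length / (mfactE N β : ℝ))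
  refine h1.congr (ae_of_all _ fun y => ?_)
  have := congrFun hgA y
  simp only at this ⊢
  rw [this]
  ring

theorem CondG.integral_mpowE_mul_gA_eq_zero (hG : CondG N G γ d L) {α β : Fin N → ℕ}
    (hβ : ∑ i, β i ≤ γ) (hα : ((∑ i, α i : ℕ) : ℝ) < L) (hβα : ¬β ≤ α) :
    ∫ x, mpowE N α x * gA N G β x 0 = 0 := by
  obtain ⟨l, hcount, hlen, -, hgA⟩ := hG.decayCD_gA hβ
  obtain ⟨k, hk⟩ : ∃ k, α k < β k := by simpa [Pi.le_def] using hβα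
  have h1 : ∀ x, mpowE N α x * gA N G β x 0 = ((-1 : ℝ) ^ l.length / (mfactE N β : ℝ)) *
      (mpowE N α x * l.foldr (pderivE N) (fun y => G y 1) x) := fun x => by
    have := congrFun hgA x
    beta_reduce at this
    rw [this]; ring
  simp_rw [h1]
  rw [integral_const_mul, integral_mpowE_mul_foldr_pderivE_eq_zero
    (hG.decayCD.of_le (by omega)) (by linarith) (k := k) (by rwa [hcount]), mul_zero]

theorem CondG.integral_mpowE_mul_gA_self (hG : CondG N G γ d L) {α : Fin N → ℕ}
    (hαγ : ∑ i, α i ≤ γ) (hα : ((∑ i, α i : ℕ) : ℝ) < L) :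
    ∫ x, mpowE N α x * gA N G α x 0 = ∫ x, G x 1 := by
  obtain ⟨l, hcount, hlen, -, hgA⟩ := hG.decayCD_gA hαγ
  have h1 : ∀ x, mpowE N α x * gA N G α x 0 = ((-1 : ℝ) ^ l.length / (mfactE N α : ℝ)) *
      (mpowE N α x * l.foldr (pderivE N) (fun y => G y 1) x) := fun x => by
    have := congrFun hgA x
    beta_reduce at this
    rw [this]; ring
  have h2 : (mfactE N α : ℝ) ≠ 0 := by
    rw [mfactE]
    exact_mod_cast Finset.prod_ne_zero_iff.2 fun i _ => Nat.factorial_ne_zero _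
  have h3 : ((-1 : ℝ) ^ l.length) * (-1) ^ l.length = 1 := by rw [← mul_pow]; simp
  simp_rw [h1]
  rw [integral_const_mul, integral_mpowE_mul_foldr_pderivE_self
    (hG.decayCD.of_le (by omega)) (by linarith) hcount]
  field_simp
  linear_combination (∫ x, G x 1) * h3

end Kernel

section Remainder

variable {N γ : ℕ} {d L K : ℝ} {G : EuclideanSpace ℝ (Fin N) → ℝ → ℝ}

theorem McoefAux_eq (f : EuclideanSpace ℝ (Fin N) → ℝ) (t : ℝ) (n : ℕ) (α : Fin N → ℕ)
    (hα : ∑ i, α i ≤ n) :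
    McoefAux N G f t n α = momE N α f - ∑ β ∈ (Finset.Iic α).erase α,
      Mcoef N G f t β * ∫ x, mpowE N α x * gA N G β x t := by
  induction n using Nat.strong_induction_on generalizing α with
  | h n ih =>
    have hlt : ∀ β ∈ (Finset.Iic α).erase α, ∑ i, β i < ∑ i, α i := fun β hβ => by
      obtain ⟨h1, h2⟩ := Finset.mem_erase.1 hβ
      have h3 : β < α := lt_of_le_of_ne (Finset.mem_Iic.1 h2) h1
      obtain ⟨h4, i, h5⟩ := Pi.lt_def.1 h3
      exact Finset.sum_lt_sum (fun i _ => h4 i) ⟨i, Finset.mem_univ i, h5⟩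
    cases n with
    | zero =>
      rw [McoefAux, Finset.sum_eq_zero fun β hβ => absurd (hlt β hβ) (by omega), sub_zero]
    | succ n =>
      rw [McoefAux]
      refine congrArg _ (Finset.sum_congr rfl fun β hβ => ?_)
      have h1 := hlt β hβ
      rw [Mcoef, ih n (by omega) β (by omega), ih _ (by omega) β le_rfl]

theorem momE_eq_sum_Mcoef {f : EuclideanSpace ℝ (Fin N) → ℝ} {t : ℝ} {α : Fin N → ℕ}
    (hα : ∫ x, mpowE N α x * gA N G α x t = 1) :
    momE N α f = ∑ β ∈ Finset.Iic α, Mcoef N G f t β * ∫ x, mpowE N α x * gA N G β x t := by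
  rw [← Finset.sum_erase_add _ _ (Finset.mem_Iic.2 le_rfl), hα, mul_one, Mcoef,
    McoefAux_eq f t _ α le_rfl]
  ring

theorem mem_multiIdx {m : ℕ} {β : Fin N → ℕ} : β ∈ multiIdx N m ↔ ∑ i, β i ≤ m := by
  simp only [multiIdx, Finset.mem_filter, Finset.mem_Iic, and_iff_right_iff_imp]
  exact fun h i =>
    (Finset.single_le_sum (f := β) (fun _ _ => Nat.zero_le _) (Finset.mem_univ i)).trans h

theorem MemL1k.integrable_weight_mul (hK : 0 ≤ K) {φ : EuclideanSpace ℝ (Fin N) → ℝ}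
    (hφ : MemL1k N K φ) : Integrable fun y => (1 + ‖y‖) ^ K * φ y := by
  have hm : Measurable fun y : EuclideanSpace ℝ (Fin N) => (1 + ‖y‖) ^ K := by fun_prop
  refine ⟨hm.aestronglyMeasurable.mul hφ.1, ?_⟩
  have h1 : ∀ y : EuclideanSpace ℝ (Fin N), ‖(1 + ‖y‖) ^ K * φ y‖ₑ ≤
      ENNReal.ofReal (2 ^ K) * ENNReal.ofReal ((1 + ‖y‖ ^ K) * ‖φ y‖) := fun y => by
    rw [← ENNReal.ofReal_mul (by positivity), ← ofReal_norm, norm_mul,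
      Real.norm_of_nonneg (by positivity), ← mul_assoc]
    gcongr
    have h2 : (1 + ‖y‖) ^ K ≤ (2 * max 1 ‖y‖) ^ K := by
      gcongr
      linarith [le_max_left 1 ‖y‖, le_max_right 1 ‖y‖]
    rw [Real.mul_rpow zero_le_two (by positivity)] at h2
    refine h2.trans ?_
    gcongr
    have h3 := Real.rpow_nonneg (norm_nonneg y) K
    rcases max_choice 1 ‖y‖ with h | h <;> rw [h]
    · rw [Real.one_rpow]; linarith
    · linarith
  calc ∫⁻ y, ‖(1 + ‖y‖) ^ K * φ y‖ₑ
      ≤ ∫⁻ y, ENNReal.ofReal (2 ^ K) * ENNReal.ofReal ((1 + ‖y‖ ^ K) * ‖φ y‖) :=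
        lintegral_mono h1
    _ = ENNReal.ofReal (2 ^ K) * wnorm N K φ := lintegral_const_mul' _ _ ENNReal.ofReal_ne_top
    _ < ⊤ := ENNReal.mul_lt_top ENNReal.ofReal_lt_top hφ.2

theorem CondG.integrable_weight_mul_PKop (hG : CondG N G γ d L) (hK : 0 ≤ K) (hKL : K < L)
    (hKγ : ⌊K⌋₊ ≤ γ) {φ : EuclideanSpace ℝ (Fin N) → ℝ} (hφ : MemL1k N K φ) :
    Integrable fun y => (1 + ‖y‖) ^ K * PKop N G K 0 φ y := by
  have h1 : Integrable fun y => (1 + ‖y‖) ^ K * φ y -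
      ∑ β ∈ multiIdx N ⌊K⌋₊, Mcoef N G φ 0 β * ((1 + ‖y‖) ^ K * gA N G β y 0) :=
    (hφ.integrable_weight_mul hK).sub <| integrable_finsetSum _ fun β hβ =>
      (hG.integrable_weight_mul_gA ((mem_multiIdx.1 hβ).trans hKγ) hKL).const_mul _
  refine h1.congr (ae_of_all _ fun y => ?_)
  simp only [PKop, mul_sub, Finset.mul_sum, mul_left_comm]

theorem CondG.momE_PKop_eq_zero (hG : CondG N G γ d L) (hG1 : ∫ x, G x 1 = 1) (hK : 0 ≤ K)
    (hKL : K < L) (hKγ : ⌊K⌋₊ ≤ γ) {φ : EuclideanSpace ℝ (Fin N) → ℝ} (hφ : MemL1k N K φ)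
    {α : Fin N → ℕ} (hα : ((∑ i, α i : ℕ) : ℝ) ≤ K) : momE N α (PKop N G K 0 φ) = 0 := by
  have hαK : ∑ i, α i ≤ ⌊K⌋₊ := Nat.le_floor hα
  have hsub : Finset.Iic α ⊆ multiIdx N ⌊K⌋₊ := fun β hβ =>
    mem_multiIdx.2 ((Finset.sum_le_sum fun i _ => Finset.mem_Iic.1 hβ i).trans hαK)
  have h1 : ∀ β ∈ multiIdx N ⌊K⌋₊, Integrable fun x =>
      Mcoef N G φ 0 β * (mpowE N α x * gA N G β x 0) := fun β hβ =>
    (integrable_mpowE_mul_of_weight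
      (hG.integrable_weight_mul_gA ((mem_multiIdx.1 hβ).trans hKγ) hKL) hα).const_mul _
  have h2 : momE N α (PKop N G K 0 φ) = ∫ x, mpowE N α x * φ x -
      ∑ β ∈ multiIdx N ⌊K⌋₊, Mcoef N G φ 0 β * (mpowE N α x * gA N G β x 0) := by
    simp only [momE, PKop, mul_sub, Finset.mul_sum, mul_left_comm]
  rw [h2, integral_sub (integrable_mpowE_mul_of_weight (hφ.integrable_weight_mul hK) hα)
    (integrable_finsetSum _ h1), integral_finsetSum _ h1, sub_eq_zero]
  simp only [integral_const_mul]
  rw [← Finset.sum_subset hsub fun β hβ hβα => by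
    rw [hG.integral_mpowE_mul_gA_eq_zero ((mem_multiIdx.1 hβ).trans hKγ) (hα.trans_lt hKL)
      (by simpa using hβα), mul_zero]]
  exact momE_eq_sum_Mcoef
    ((hG.integral_mpowE_mul_gA_self (hαK.trans hKγ) (hα.trans_lt hKL)).trans hG1)

theorem CondG.sgOp_sub_sum_eq (hG : CondG N G γ d L) (hd : 0 < d) (hL : 0 < L) (hK : 0 ≤ K)
    (hKL : K < L) (hKγ : ⌊K⌋₊ ≤ γ) {φ : EuclideanSpace ℝ (Fin N) → ℝ} (hφ : MemL1k N K φ)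
    {t : ℝ} (ht : 0 < t) :
    (fun y => sgOp N G t φ y - ∑ α ∈ multiIdx N ⌊K⌋₊, Mcoef N G φ 0 α * gA N G α y t) =
      sgOp N G t (PKop N G K 0 φ) := by
  ext x
  obtain ⟨C, hC⟩ := hG.exists_norm_le hd hL ht
  have hcont : Continuous fun x => G x t := (hG.contDiff ht).continuous
  have hint : ∀ {f : EuclideanSpace ℝ (Fin N) → ℝ},
      (Integrable fun y => (1 + ‖y‖) ^ K * f y) → Integrable fun y => G (x - y) t * f y :=
    fun hf => (integrable_of_integrable_weight hK hf).bdd_mul (c := C)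
      (hcont.comp (by fun_prop : Continuous fun y => x - y)).aestronglyMeasurable
      (ae_of_all _ fun y => hC _)
  have h1 : ∀ β ∈ multiIdx N ⌊K⌋₊, Integrable fun y =>
      Mcoef N G φ 0 β * (G (x - y) t * gA N G β y 0) := fun β hβ =>
    (hint (hG.integrable_weight_mul_gA ((mem_multiIdx.1 hβ).trans hKγ) hKL)).const_mul _
  have h2 : sgOp N G t (PKop N G K 0 φ) x = ∫ y, G (x - y) t * φ y -
      ∑ β ∈ multiIdx N ⌊K⌋₊, Mcoef N G φ 0 β * (G (x - y) t * gA N G β y 0) := by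
    simp only [sgOp, PKop, mul_sub, Finset.mul_sum, mul_left_comm]
  rw [h2, integral_sub (hint (hφ.integrable_weight_mul hK)) (integrable_finsetSum _ h1),
    integral_finsetSum _ h1]
  simp only [integral_const_mul]
  refine congrArg _ (Finset.sum_congr rfl fun β hβ => ?_)
  rw [hG.gA_eq_sgOp hd hL ((mem_multiIdx.1 hβ).trans hKγ) ht]
  rfl

end Remainder

theorem eLpNorm_le_rpow_mul {α F : Type*} [MeasurableSpace α] [NormedAddCommGroup F]
    {μ : Measure α} {f : α → F} {B M : ℝ≥0∞} (hB : B ≠ ⊤) (hM : M ≠ ⊤)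
    (hf : ∀ x, ‖f x‖ₑ ≤ B * M) (hint : ∫⁻ x, ‖f x‖ₑ ∂μ ≤ M) {q : ℝ≥0∞} (hq : 1 ≤ q) :
    eLpNorm f q μ ≤ B ^ (1 - q.toReal⁻¹) * M := by
  rcases eq_or_ne q ⊤ with rfl | hq'
  · rw [eLpNorm_exponent_top, ENNReal.toReal_top, inv_zero, sub_zero, ENNReal.rpow_one]
    exact essSup_le_of_ae_le _ (ae_of_all _ hf)
  have hp : 1 ≤ q.toReal := by simpa using (ENNReal.toReal_le_toReal ENNReal.one_ne_top hq').2 hq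
  have hp0 : 0 < q.toReal := by linarith
  rw [eLpNorm_eq_lintegral_rpow_enorm_toReal (by positivity) hq', one_div]
  generalize q.toReal = p at hp hp0
  have h1 : ∫⁻ x, ‖f x‖ₑ ^ p ∂μ ≤ (B * M) ^ (p - 1) * M := by
    calc ∫⁻ x, ‖f x‖ₑ ^ p ∂μ ≤ ∫⁻ x, (B * M) ^ (p - 1) * ‖f x‖ₑ ∂μ := by
          refine lintegral_mono fun x => ?_
          calc ‖f x‖ₑ ^ p = ‖f x‖ₑ ^ (p - 1) * ‖f x‖ₑ := by
                conv_rhs => rw [← ENNReal.rpow_one ‖f x‖ₑ, ← ENNReal.rpow_mul, one_mul,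
                  ← ENNReal.rpow_add_of_nonneg _ _ (by linarith) zero_le_one, sub_add_cancel]
            _ ≤ _ := by
                gcongr
                · exact hf x
      _ = (B * M) ^ (p - 1) * ∫⁻ x, ‖f x‖ₑ ∂μ := lintegral_const_mul' _ _
          (ENNReal.rpow_ne_top_of_nonneg (by linarith) (ENNReal.mul_ne_top hB hM))
      _ ≤ _ := by gcongr
  have h2 : (p - 1) * p⁻¹ = 1 - p⁻¹ := by field_simp
  have h3 : 0 ≤ 1 - p⁻¹ := by linarith [inv_le_one_of_one_le₀ hp]
  calc _ ≤ ((B * M) ^ (p - 1) * M) ^ p⁻¹ := ENNReal.rpow_le_rpow h1 (by positivity)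
    _ = B ^ (1 - p⁻¹) * (M ^ (1 - p⁻¹) * M ^ p⁻¹) := by
        rw [ENNReal.mul_rpow_of_nonneg _ _ (by positivity), ← ENNReal.rpow_mul, h2,
          ENNReal.mul_rpow_of_nonneg _ _ h3, mul_assoc]
    _ = _ := by
        rw [← ENNReal.rpow_add_of_nonneg _ _ h3 (by positivity), sub_add_cancel, ENNReal.rpow_one]

section Estimates

variable {N γ : ℕ} {d L K : ℝ} {G : EuclideanSpace ℝ (Fin N) → ℝ → ℝ}

/-- The `L¹` norm with respect to the dilated weight `(1 + |a⁻¹ x|) ^ K`. -/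
noncomputable def dilNorm (N : ℕ) {F : Type*} [NormedAddCommGroup F] (K a : ℝ)
    (u : EuclideanSpace ℝ (Fin N) → F) : ℝ≥0∞ :=
  ∫⁻ x, ENNReal.ofReal ((1 + ‖a⁻¹ • x‖) ^ K) * ‖u x‖ₑ

theorem lintegral_enorm_le_dilNorm {F : Type*} [NormedAddCommGroup F] (hK : 0 ≤ K) (a : ℝ)
    (u : EuclideanSpace ℝ (Fin N) → F) : ∫⁻ x, ‖u x‖ₑ ≤ dilNorm N K a u := by
  refine lintegral_mono fun x => le_mul_of_one_le_left' ?_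
  rw [ENNReal.one_le_ofReal]
  exact Real.one_le_rpow (by linarith [norm_nonneg (a⁻¹ • x)]) hK

theorem wnorm_le_mul_dilNorm {F : Type*} [NormedAddCommGroup F] {a ℓ : ℝ} (ha : 1 ≤ a)
    (hℓ : ℓ ∈ Set.Icc 0 K) (u : EuclideanSpace ℝ (Fin N) → F) :
    wnorm N ℓ u ≤ ENNReal.ofReal (2 * a ^ ℓ) * dilNorm N K a u := by
  have ha0 : 0 < a := by linarith
  rw [wnorm, dilNorm, ← lintegral_const_mul' _ _ ENNReal.ofReal_ne_top]
  refine lintegral_mono fun x => ?_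
  rw [← ofReal_norm, ← ENNReal.ofReal_mul (by positivity), ← ENNReal.ofReal_mul (by positivity),
    ← mul_assoc]
  gcongr
  have h1 : (1 + ‖a⁻¹ • x‖) ^ ℓ ≤ (1 + ‖a⁻¹ • x‖) ^ K :=
    Real.rpow_le_rpow_of_exponent_le (by linarith [norm_nonneg (a⁻¹ • x)]) hℓ.2
  have h2 : ‖x‖ ^ ℓ ≤ a ^ ℓ * (1 + ‖a⁻¹ • x‖) ^ ℓ := by
    rw [← Real.mul_rpow ha0.le (by positivity)]
    refine Real.rpow_le_rpow (norm_nonneg _) ?_ hℓ.1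
    rw [norm_smul, norm_inv, Real.norm_of_nonneg ha0.le, mul_add, mul_inv_cancel_left₀ ha0.ne']
    linarith
  have h3 : 1 ≤ a ^ ℓ * (1 + ‖a⁻¹ • x‖) ^ ℓ := by
    rw [← Real.mul_rpow ha0.le (by positivity)]
    exact Real.one_le_rpow (by nlinarith [norm_nonneg (a⁻¹ • x)]) hℓ.1
  have h4 : a ^ ℓ * (1 + ‖a⁻¹ • x‖) ^ ℓ ≤ a ^ ℓ * (1 + ‖a⁻¹ • x‖) ^ K := by gcongr
  linarith

theorem CondG.tendsto_rpow_mul_dilNorm_sgOp (hG : CondG N G γ d L) (hd : 0 < d) (hL : 0 < L)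
    (hK : 0 ≤ K) (hKL : K < L) (hKγ : ⌊K⌋₊ + 1 ≤ γ) {ψ : EuclideanSpace ℝ (Fin N) → ℝ}
    (hψ : Integrable fun y => (1 + ‖y‖) ^ K * ψ y)
    (hmom : ∫ x, G x 1 = 1 → ∀ α : Fin N → ℕ, ((∑ i, α i : ℕ) : ℝ) ≤ K → momE N α ψ = 0) :
    Tendsto (fun a : ℝ => ENNReal.ofReal (a ^ K) * dilNorm N K a (sgOp N G (a ^ d) ψ))
      atTop (𝓝 0) := by
  have h1 : Tendsto (fun a : ℝ => ENNReal.ofReal (a ^ K) *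
      ∫⁻ x, ENNReal.ofReal ((1 + ‖x‖) ^ K) * ‖∫ y, ψ y • G (x - a⁻¹ • y) 1‖ₑ) atTop (𝓝 0) := by
    rcases hG.integral_eq_one_or_eq_zero hd hL with h | h
    · have hdec : DecayCD (N + L) (⌊K⌋₊ + 1) fun x => G x 1 := hG.decayCD.of_le hKγ
      have := tendsto_rpow_mul_lintegral_weight hdec (Nat.floor_le hK) (Nat.lt_floor_add_one K)
        (by linarith) hψ (hmom h)
      exact this
    · simp [h]
  refine h1.congr' ?_
  filter_upwards [eventually_gt_atTop 0] with a ha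
  congr 1
  have h2 : ∀ x, sgOp N G (a ^ d) ψ x = (a ^ N)⁻¹ * ∫ y, ψ y • G (a⁻¹ • x - a⁻¹ • y) 1 :=
    fun x => by
      rw [sgOp_eq_integral_smul, ← integral_const_mul]
      congr 1
      ext y
      rw [hG.apply_rpow hd ha, smul_sub, smul_eq_mul, smul_eq_mul, mul_left_comm]
  have h3 := lintegral_comp_smul_addHaar volume (fun x : EuclideanSpace ℝ (Fin N) =>
    ENNReal.ofReal ((1 + ‖x‖) ^ K) * ‖(a ^ N)⁻¹ * ∫ y, ψ y • G (x - a⁻¹ • y) 1‖ₑ)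
    (inv_ne_zero ha.ne')
  simp_rw [dilNorm, h2]
  rw [h3, ← lintegral_const_mul' _ _ ENNReal.ofReal_ne_top]
  congr 1
  ext x
  rw [finrank_euclideanSpace_fin, inv_pow, inv_inv, abs_of_pos (by positivity), enorm_mul,
    Real.enorm_of_nonneg (by positivity : 0 ≤ (a ^ N)⁻¹),
    mul_left_comm _ (ENNReal.ofReal (a ^ N)⁻¹),
    ← mul_assoc, ← ENNReal.ofReal_mul (by positivity), mul_inv_cancel₀ (by positivity),
    ENNReal.ofReal_one, one_mul]

theorem CondG.iteratedFDeriv_sgOp (hG : CondG N G γ d L) (hd : 0 < d) (hL : 0 < L) {t : ℝ}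
    (ht : 0 < t) {u : EuclideanSpace ℝ (Fin N) → ℝ} (hu : Integrable u) {j : ℕ} (hj : j ≤ γ) :
    iteratedFDeriv ℝ j (sgOp N G t u) =
      fun x => ∫ y, u y • iteratedFDeriv ℝ j (fun y => G y t) (x - y) := by
  rw [← iteratedFDeriv_integral_smul_comp_sub hu (hG.contDiff ht)
    (fun i hi => hG.exists_norm_iteratedFDeriv_le hd hL ht hi) hj]
  congr 1
  ext x
  exact sgOp_eq_integral_smul t u x

theorem CondG.exists_enorm_iteratedFDeriv_sgOp_le (hG : CondG N G γ d L) (hd : 0 < d) (hL : 0 < L)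
    (hK : 0 ≤ K) (hKL : K < L) {j : ℕ} (hj : j ≤ γ) :
    ∃ D : ℝ, 0 ≤ D ∧ ∀ a : ℝ, 0 < a → ∀ u : EuclideanSpace ℝ (Fin N) → ℝ, Integrable u →
      (∀ x, ‖iteratedFDeriv ℝ j (sgOp N G (a ^ d) u) x‖ₑ ≤
        ENNReal.ofReal (a ^ N)⁻¹ * (ENNReal.ofReal ((a ^ j)⁻¹ * D) * dilNorm N K a u)) ∧
      dilNorm N K a (iteratedFDeriv ℝ j (sgOp N G (a ^ d) u)) ≤
        ENNReal.ofReal ((a ^ j)⁻¹ * D) * dilNorm N K a u := by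
  obtain ⟨C, hC0, hC⟩ := hG.norm_iteratedFDeriv_le hd hj
  have hAint : Integrable fun z : EuclideanSpace ℝ (Fin N) => (1 + ‖z‖) ^ (-(N + L - K)) :=
    integrable_one_add_norm (by rw [finrank_euclideanSpace_fin]; linarith)
  set A : ℝ := ∫ z : EuclideanSpace ℝ (Fin N), (1 + ‖z‖) ^ (-(N + L - K))
  have hA0 : 0 ≤ A := integral_nonneg fun z => by positivity
  have hA : ∫⁻ z : EuclideanSpace ℝ (Fin N), ENNReal.ofReal ((1 + ‖z‖) ^ (-(N + L - K))) =
      ENNReal.ofReal A :=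
    (ofReal_integral_eq_lintegral_ofReal hAint (ae_of_all _ fun z => by positivity)).symm
  have hN0 : (0 : ℝ) ≤ N := Nat.cast_nonneg N
  refine ⟨C * (1 + A), by positivity, fun a ha u hu => ?_⟩
  have hP : ∀ x, ‖iteratedFDeriv ℝ j (sgOp N G (a ^ d) u) x‖ₑ ≤ ∫⁻ y, ‖u y‖ₑ *
      ENNReal.ofReal ((a ^ (N + j))⁻¹ * (C * (1 + ‖a⁻¹ • (x - y)‖) ^ (-(N + L)))) := fun x => by
    rw [hG.iteratedFDeriv_sgOp hd hL (by positivity) hu hj]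
    refine (enorm_integral_le_lintegral_enorm _).trans (lintegral_mono fun y => ?_)
    rw [enorm_smul, ← ofReal_norm (iteratedFDeriv _ _ _ _)]
    gcongr
    exact hC a ha _
  constructor
  · intro x
    refine (hP x).trans ?_
    rw [dilNorm, ← lintegral_const_mul' _ _ ENNReal.ofReal_ne_top,
      ← lintegral_const_mul' _ _ ENNReal.ofReal_ne_top]
    refine lintegral_mono fun y => ?_
    have h1 : (1 + ‖a⁻¹ • (x - y)‖) ^ (-(N + L)) ≤ 1 :=
      Real.rpow_le_one_of_one_le_of_nonpos (by linarith [norm_nonneg (a⁻¹ • (x - y))])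
        (by linarith)
    have h2 : 1 ≤ (1 + ‖a⁻¹ • y‖) ^ K :=
      Real.one_le_rpow (by linarith [norm_nonneg (a⁻¹ • y)]) hK
    have h3 : (a ^ (N + j))⁻¹ * (C * (1 + ‖a⁻¹ • (x - y)‖) ^ (-(N + L))) ≤
        (a ^ N)⁻¹ * ((a ^ j)⁻¹ * (C * (1 + A)) * (1 + ‖a⁻¹ • y‖) ^ K) :=
      calc _ ≤ (a ^ (N + j))⁻¹ * (C * 1) := by gcongr
        _ ≤ (a ^ (N + j))⁻¹ * ((C * (1 + A)) * (1 + ‖a⁻¹ • y‖) ^ K) := by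
            gcongr ?_ * ?_
            calc C * 1 ≤ C * (1 + A) := by gcongr; linarith
              _ ≤ _ := le_mul_of_one_le_right (by positivity) h2
        _ = _ := by rw [pow_add, mul_inv]; ring
    calc _ ≤ ‖u y‖ₑ * ENNReal.ofReal
          ((a ^ N)⁻¹ * ((a ^ j)⁻¹ * (C * (1 + A)) * (1 + ‖a⁻¹ • y‖) ^ K)) := by gcongr
      _ = _ := by
          rw [ENNReal.ofReal_mul (by positivity), ENNReal.ofReal_mul (by positivity)]
          ring
  · have hW : ∀ y : EuclideanSpace ℝ (Fin N),
        ∫⁻ x, ENNReal.ofReal ((1 + ‖a⁻¹ • (x - y)‖) ^ (-(N + L - K))) =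
          ENNReal.ofReal (a ^ N * A) := fun y => by
      rw [lintegral_sub_right_eq_self
        (fun x => ENNReal.ofReal ((1 + ‖a⁻¹ • x‖) ^ (-(N + L - K)))) y,
        lintegral_comp_smul_addHaar volume (fun x : EuclideanSpace ℝ (Fin N) =>
          ENNReal.ofReal ((1 + ‖x‖) ^ (-(N + L - K)))) (inv_ne_zero ha.ne'), hA,
        finrank_euclideanSpace_fin, inv_pow, inv_inv, abs_of_pos (by positivity),
        ENNReal.ofReal_mul (by positivity)]
    calc dilNorm N K a (iteratedFDeriv ℝ j (sgOp N G (a ^ d) u))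
        ≤ ∫⁻ x, ∫⁻ y, ENNReal.ofReal ((1 + ‖a⁻¹ • x‖) ^ K) * (‖u y‖ₑ * ENNReal.ofReal
            ((a ^ (N + j))⁻¹ * (C * (1 + ‖a⁻¹ • (x - y)‖) ^ (-(N + L))))) := by
          refine lintegral_mono fun x => ?_
          rw [lintegral_const_mul' _ _ ENNReal.ofReal_ne_top]
          gcongr
          exact hP x
      _ = ∫⁻ y, ∫⁻ x, ENNReal.ofReal ((1 + ‖a⁻¹ • x‖) ^ K) * (‖u y‖ₑ * ENNReal.ofReal
            ((a ^ (N + j))⁻¹ * (C * (1 + ‖a⁻¹ • (x - y)‖) ^ (-(N + L))))) := by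
          refine lintegral_lintegral_swap ?_
          have hue : AEMeasurable (fun p : EuclideanSpace ℝ (Fin N) × EuclideanSpace ℝ (Fin N) =>
            ‖u p.2‖ₑ) (volume.prod volume) := hu.1.comp_snd.enorm
          have hm1 : Measurable fun p : EuclideanSpace ℝ (Fin N) × EuclideanSpace ℝ (Fin N) =>
            ENNReal.ofReal ((1 + ‖a⁻¹ • p.1‖) ^ K) := by fun_prop
          have hm2 : Measurable fun p : EuclideanSpace ℝ (Fin N) × EuclideanSpace ℝ (Fin N) =>
            ENNReal.ofReal ((a ^ (N + j))⁻¹ * (C * (1 + ‖a⁻¹ • (p.1 - p.2)‖) ^ (-(N + L)))) := by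
            fun_prop
          exact hm1.aemeasurable.mul (hue.mul hm2.aemeasurable)
      _ ≤ ∫⁻ y, ∫⁻ x, (ENNReal.ofReal ((a ^ (N + j))⁻¹ * C * (1 + ‖a⁻¹ • y‖) ^ K) * ‖u y‖ₑ) *
            ENNReal.ofReal ((1 + ‖a⁻¹ • (x - y)‖) ^ (-(N + L - K))) := by
          refine lintegral_mono fun y => lintegral_mono fun x => ?_
          have h1 := one_add_norm_rpow_le_mul (x := a⁻¹ • x) (z := a⁻¹ • y) hK
          rw [← smul_sub] at h1
          have h2 : (1 + ‖a⁻¹ • (x - y)‖) ^ (-(N + L - K)) =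
              (1 + ‖a⁻¹ • (x - y)‖) ^ K * (1 + ‖a⁻¹ • (x - y)‖) ^ (-(N + L)) := by
            rw [← Real.rpow_add (by positivity)]
            congr 1
            ring
          have h3 : (1 + ‖a⁻¹ • x‖) ^ K *
              ((a ^ (N + j))⁻¹ * (C * (1 + ‖a⁻¹ • (x - y)‖) ^ (-(N + L)))) ≤
              (a ^ (N + j))⁻¹ * C * (1 + ‖a⁻¹ • y‖) ^ K *
                (1 + ‖a⁻¹ • (x - y)‖) ^ (-(N + L - K)) :=
            calc _ ≤ ((1 + ‖a⁻¹ • y‖) ^ K * (1 + ‖a⁻¹ • (x - y)‖) ^ K) *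
                  ((a ^ (N + j))⁻¹ * (C * (1 + ‖a⁻¹ • (x - y)‖) ^ (-(N + L)))) := by gcongr
              _ = _ := by rw [h2]; ring
          have h4 := mul_le_mul_right (ENNReal.ofReal_le_ofReal h3) ‖u y‖ₑ
          rw [ENNReal.ofReal_mul (p := (1 + ‖a⁻¹ • x‖) ^ K) (by positivity),
            ENNReal.ofReal_mul (p := (a ^ (N + j))⁻¹ * C * (1 + ‖a⁻¹ • y‖) ^ K)
              (by positivity)] at h4
          calc _ = ‖u y‖ₑ * (ENNReal.ofReal ((1 + ‖a⁻¹ • x‖) ^ K) * ENNReal.ofReal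
                ((a ^ (N + j))⁻¹ * (C * (1 + ‖a⁻¹ • (x - y)‖) ^ (-(N + L))))) := by ring
            _ ≤ _ := h4
            _ = _ := by ring
      _ ≤ ∫⁻ y, ENNReal.ofReal ((a ^ j)⁻¹ * (C * (1 + A))) *
            (ENNReal.ofReal ((1 + ‖a⁻¹ • y‖) ^ K) * ‖u y‖ₑ) := by
          refine lintegral_mono fun y => ?_
          rw [lintegral_const_mul' _ _ (ENNReal.mul_ne_top ENNReal.ofReal_ne_top enorm_ne_top), hW]
          have h1 : (a ^ (N + j))⁻¹ * C * (1 + ‖a⁻¹ • y‖) ^ K * (a ^ N * A) =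
              (a ^ j)⁻¹ * (C * A) * (1 + ‖a⁻¹ • y‖) ^ K := by
            rw [pow_add]
            field_simp
          calc _ = ENNReal.ofReal ((a ^ j)⁻¹ * (C * A) * (1 + ‖a⁻¹ • y‖) ^ K) * ‖u y‖ₑ := by
                rw [← h1, mul_right_comm,
                  ENNReal.ofReal_mul (p := (a ^ (N + j))⁻¹ * C * (1 + ‖a⁻¹ • y‖) ^ K)
                    (by positivity)]
            _ ≤ ENNReal.ofReal ((a ^ j)⁻¹ * (C * (1 + A)) * (1 + ‖a⁻¹ • y‖) ^ K) * ‖u y‖ₑ := by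
                gcongr
                linarith
            _ = _ := by rw [ENNReal.ofReal_mul (by positivity), mul_assoc]
      _ = _ := lintegral_const_mul' _ _ ENNReal.ofReal_ne_top

end Estimates

section Decay

variable {N γ : ℕ} {d L K : ℝ} {G : EuclideanSpace ℝ (Fin N) → ℝ → ℝ}

theorem two_mul_rpow_rpow_div (hd : 0 < d) {a : ℝ} (ha : 0 < a) (e : ℝ) :
    (2 * a ^ d) ^ (e / d) = 2 ^ (e / d) * a ^ e := by
  rw [Real.mul_rpow zero_le_two (by positivity), ← Real.rpow_mul ha.le, mul_div_cancel₀ _ hd.ne']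

theorem CondG.exists_decay_le (hG : CondG N G γ d L) (hd : 0 < d) (hL : 0 < L) (hKL : K < L)
    {j : ℕ} (hj : j ≤ γ) {q : ℝ≥0∞} (hq : 1 ≤ q) {ℓ : ℝ} (hℓ : ℓ ∈ Set.Icc 0 K) :
    ∃ D : ℝ, ∀ a : ℝ, 1 ≤ a → ∀ ψ : EuclideanSpace ℝ (Fin N) → ℝ, Integrable ψ →
      dilNorm N K a (sgOp N G (a ^ d) ψ) ≠ ⊤ →
      ENNReal.ofReal ((2 * a ^ d) ^ (K / d)) *
        (ENNReal.ofReal ((2 * a ^ d) ^ (((N : ℝ) / d) * (1 - q.toReal⁻¹) + (j : ℝ) / d)) *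
            eLpNorm (iteratedFDeriv ℝ j (sgOp N G (2 * a ^ d) ψ)) q volume +
          ENNReal.ofReal ((2 * a ^ d) ^ (-ℓ / d + (j : ℝ) / d)) *
            wnorm N ℓ (iteratedFDeriv ℝ j (sgOp N G (2 * a ^ d) ψ))) ≤
      ENNReal.ofReal D *
        (ENNReal.ofReal (a ^ K) * dilNorm N K a (sgOp N G (a ^ d) ψ)) := by
  have hK : 0 ≤ K := hℓ.1.trans hℓ.2
  obtain ⟨D, hD0, hD⟩ := hG.exists_enorm_iteratedFDeriv_sgOp_le hd hL hK hKL hj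
  set θ := q.toReal⁻¹
  have he1 : (N : ℝ) / d * (1 - θ) + j / d = (N * (1 - θ) + j) / d := by ring
  have he2 : -ℓ / d + j / d = (-ℓ + j) / d := by ring
  refine ⟨2 ^ (K / d) * (2 ^ ((N * (1 - θ) + j) / d) * D + 2 ^ ((-ℓ + j) / d) * (2 * D)),
    fun a ha ψ hψ hJ => ?_⟩
  have ha0 : 0 < a := by linarith
  have had : 0 < a ^ d := by positivity
  obtain ⟨hD1, hD2⟩ := hD a ha0 _ (hG.integrable_sgOp hd hL had hψ)
  rw [hG.sgOp_sgOp hd hL had had hψ, ← two_mul] at hD1 hD2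
  rw [he1, he2]
  simp only [two_mul_rpow_rpow_div hd ha0]
  set J := dilNorm N K a (sgOp N G (a ^ d) ψ)
  set M := ENNReal.ofReal ((a ^ j)⁻¹ * D) * J with hM
  have hMtop : M ≠ ⊤ := ENNReal.mul_ne_top ENNReal.ofReal_ne_top hJ
  have h1 := eLpNorm_le_rpow_mul ENNReal.ofReal_ne_top hMtop hD1
    ((lintegral_enorm_le_dilNorm hK a _).trans hD2) hq
  have h2 := (wnorm_le_mul_dilNorm ha hℓ _).trans (mul_le_mul_right hD2 _)
  have h3 : a ^ (N * (1 - θ) + j) * (((a ^ N)⁻¹) ^ (1 - θ) * (a ^ j)⁻¹) = 1 := by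
    rw [Real.rpow_add ha0, Real.rpow_mul ha0.le, Real.rpow_natCast, Real.rpow_natCast,
      Real.inv_rpow (by positivity)]
    field_simp
  have h4 : a ^ (-ℓ + j) * (a ^ ℓ * (a ^ j)⁻¹) = 1 := by
    rw [Real.rpow_add ha0, Real.rpow_neg ha0.le, Real.rpow_natCast]
    field_simp
  rw [ENNReal.ofReal_rpow_of_pos (by positivity)] at h1
  calc _ ≤ ENNReal.ofReal (2 ^ (K / d) * a ^ K) *
        (ENNReal.ofReal (2 ^ ((N * (1 - θ) + j) / d) * a ^ (N * (1 - θ) + j)) *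
            (ENNReal.ofReal (((a ^ N)⁻¹) ^ (1 - θ)) * M) +
          ENNReal.ofReal (2 ^ ((-ℓ + j) / d) * a ^ (-ℓ + j)) *
            (ENNReal.ofReal (2 * a ^ ℓ) * M)) := by gcongr
    _ = ENNReal.ofReal (2 ^ (K / d) * a ^ K *
        (2 ^ ((N * (1 - θ) + j) / d) * a ^ (N * (1 - θ) + j) *
            (((a ^ N)⁻¹) ^ (1 - θ) * ((a ^ j)⁻¹ * D)) +
          2 ^ ((-ℓ + j) / d) * a ^ (-ℓ + j) * (2 * a ^ ℓ * ((a ^ j)⁻¹ * D)))) * J := by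
        rw [hM, ← mul_assoc, ← mul_assoc, ← mul_assoc, ← mul_assoc, ← add_mul, ← mul_assoc,
          ← ENNReal.ofReal_mul (by positivity), ← ENNReal.ofReal_mul (by positivity),
          ← ENNReal.ofReal_mul (by positivity), ← ENNReal.ofReal_mul (by positivity),
          ← ENNReal.ofReal_add (by positivity) (by positivity),
          ← ENNReal.ofReal_mul (by positivity)]
        simp only [mul_assoc]
    _ = _ := by
        rw [← mul_assoc (ENNReal.ofReal _), ← ENNReal.ofReal_mul (by positivity)]
        congr 2
        linear_combination 2 ^ (K / d) * a ^ K * D *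
          (2 ^ ((N * (1 - θ) + j) / d) * h3 + 2 * 2 ^ ((-ℓ + j) / d) * h4)

end Decay

/-- Theorem 1.1 (convergence): for the linearized remainder
`v(x,t) = e^{tℒ}φ(x) - ∑_{|α|≤K} M_α(φ,0) g_α(x,t)`, one has
`t^{K/d}[t^{(N/d)(1-1/q)+j/d}‖∇ʲv(t)‖_q + t^{-ℓ/d+j/d}|||∇ʲv(t)|||_ℓ] → 0`
as `t → ∞`. -/
theorem stmt1 (N γ : ℕ) (hN : 1 ≤ N) (d L : ℝ) (hd : 0 < d) (hL : 0 < L)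
    (G : EuclideanSpace ℝ (Fin N) → ℝ → ℝ) (hG : CondG N G γ d L)
    (K : ℝ) (hK0 : 0 ≤ K) (hKL : K < L) (hKγ : ⌈K⌉₊ + 1 ≤ γ)
    (j : ℕ) (hj : j ≤ γ) (q : ℝ≥0∞) (hq : 1 ≤ q) (ℓ : ℝ) (hℓ : ℓ ∈ Set.Icc 0 K)
    (φ : EuclideanSpace ℝ (Fin N) → ℝ) (hφ : MemL1k N K φ) :
    Tendsto (fun t : ℝ =>
      ENNReal.ofReal (t ^ (K / d)) *
        (ENNReal.ofReal (t ^ (((N : ℝ) / d) * (1 - q.toReal⁻¹) + (j : ℝ) / d)) *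
            eLpNorm (fun x => iteratedFDeriv ℝ j
              (fun y => sgOp N G t φ y -
                ∑ α ∈ multiIdx N ⌊K⌋₊, Mcoef N G φ 0 α * gA N G α y t) x) q volume +
          ENNReal.ofReal (t ^ (-ℓ / d + (j : ℝ) / d)) *
            wnorm N ℓ (fun x => iteratedFDeriv ℝ j
              (fun y => sgOp N G t φ y -
                ∑ α ∈ multiIdx N ⌊K⌋₊, Mcoef N G φ 0 α * gA N G α y t) x)))
      atTop (nhds 0) := by
  have hKγ' : ⌊K⌋₊ + 1 ≤ γ := by
    have := Nat.floor_le_ceil K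
    omega
  have hψw := hG.integrable_weight_mul_PKop hK0 hKL (by omega) hφ
  have hψ := integrable_of_integrable_weight hK0 hψw
  have hJ := hG.tendsto_rpow_mul_dilNorm_sgOp hd hL hK0 hKL hKγ' hψw
    fun h1 α hα => hG.momE_PKop_eq_zero h1 hK0 hKL (by omega) hφ hα
  obtain ⟨D, hD⟩ := hG.exists_decay_le hd hL hKL hj hq hℓ
  have ha : Tendsto (fun t : ℝ => (t / 2) ^ d⁻¹) atTop atTop :=
    (tendsto_rpow_atTop (inv_pos.2 hd)).comp (tendsto_id.atTop_div_const zero_lt_two)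
  have hlim := (ENNReal.Tendsto.const_mul (a := ENNReal.ofReal D) hJ
    (Or.inr ENNReal.ofReal_ne_top)).comp ha
  rw [mul_zero] at hlim
  refine tendsto_of_tendsto_of_tendsto_of_le_of_le' tendsto_const_nhds hlim
    (Eventually.of_forall fun _ => zero_le) ?_
  filter_upwards [ha.eventually_ge_atTop 1, eventually_gt_atTop 0,
    ha.eventually (hJ.eventually (gt_mem_nhds zero_lt_one))] with t hat ht htop
  have hat0 : 0 < (t / 2) ^ d⁻¹ := by linarith
  have h2 : 2 * ((t / 2) ^ d⁻¹) ^ d = t := by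
    rw [← Real.rpow_mul (by positivity), inv_mul_cancel₀ hd.ne', Real.rpow_one]
    ring
  have hne : dilNorm N K ((t / 2) ^ d⁻¹) (sgOp N G (((t / 2) ^ d⁻¹) ^ d) (PKop N G K 0 φ)) ≠ ⊤ := by
    intro h
    rw [h, ENNReal.mul_top (by positivity)] at htop
    exact not_top_lt htop
  have h3 := hD _ hat _ hψ hne
  rw [h2] at h3
  rw [hG.sgOp_sub_sum_eq hd hL hK0 hKL (by omega) hφ ht]
  exact h3
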